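/- arXiv:1605.02078 — 8 statements merged into one kernel-verified Lean document; each statement's English description precedes it below -/
import Mathlib

section
/- Let X, Y, Z, A, B, C be random variables whose joint distribution factorizes as P_{XYZABC} = P_A · P_B · P_C · P_{X|BC} · P_{Y|AC} · P_{Z|AB}. Then for every integer s ≥ 1: (−s²/2 − 3s/2 − 2)·(H(X) + H(Z) − H(XY)) − (2s+2)·H(Y) + (s² + 2)·H(XZ) + (s²/2 + 3s/2 + 1)·H(YZ) − (s² + 1)·H(XYZ) ≥ 0, and the same inequality holds for all permutations of the roles of X, Y and Z. -/
open Finset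
open scoped Classical

/-- Probability that the random variable `X` (on the finite weighted sample space
`(Ω, μ)`) takes the value `b`. -/
noncomputable def pr {Ω β : Type*} [Fintype Ω] (μ : Ω → ℝ) (X : Ω → β) (b : β) : ℝ :=
  ∑ ω, if X ω = b then μ ω else 0

/-- Shannon entropy of the random variable `X` on the finite weighted sample space
`(Ω, μ)`. -/
noncomputable def ent {Ω β : Type*} [Fintype Ω] [Fintype β] (μ : Ω → ℝ) (X : Ω → β) : ℝ :=
  ∑ b, Real.negMulLog (pr μ X b)

/-- Mutual information `I(X : Y)`. -/
noncomputable def mi {Ω β γ : Type*} [Fintype Ω] [Fintype β] [Fintype γ]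
    (μ : Ω → ℝ) (X : Ω → β) (Y : Ω → γ) : ℝ :=
  ent μ X + ent μ Y - ent μ (fun ω => (X ω, Y ω))

/-- Conditional mutual information `I(X : Y | Z)`. -/
noncomputable def cmi {Ω β γ δ : Type*} [Fintype Ω] [Fintype β] [Fintype γ] [Fintype δ]
    (μ : Ω → ℝ) (X : Ω → β) (Y : Ω → γ) (Z : Ω → δ) : ℝ :=
  ent μ (fun ω => (X ω, Z ω)) + ent μ (fun ω => (Y ω, Z ω)) - ent μ Z
    - ent μ (fun ω => (X ω, Y ω, Z ω))

/-- The Ingleton quantity `I_ING(S,T;U,V)`. -/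
noncomputable def ing {Ω β γ δ ε : Type*} [Fintype Ω] [Fintype β] [Fintype γ] [Fintype δ]
    [Fintype ε] (μ : Ω → ℝ) (S : Ω → β) (T : Ω → γ) (U : Ω → δ) (V : Ω → ε) : ℝ :=
  cmi μ S T U + cmi μ S T V + mi μ U V - mi μ S T

/-- The marginal inequality (16) of Proposition 4 (derived from the second Matúš family),
with roles `(P, Q, R)` standing for a permutation of `(X, Y, Z)`:
`(−s²/2 − 3s/2 − 2)(H(P) + H(R) − H(PQ)) − (2s+2)H(Q) + (s² + 2)H(PR)
  + (s²/2 + 3s/2 + 1)H(QR) − (s² + 1)H(PQR) ≥ 0`. -/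
def matusMarg3 {Ω β γ δ : Type*} [Fintype Ω] [Fintype β] [Fintype γ] [Fintype δ]
    (s : ℝ) (μ : Ω → ℝ) (P : Ω → β) (Q : Ω → γ) (R : Ω → δ) : Prop :=
  0 ≤ (-(s ^ 2) / 2 - 3 * s / 2 - 2)
        * (ent μ P + ent μ R - ent μ (fun ω => (P ω, Q ω)))
    - (2 * s + 2) * ent μ Q
    + (s ^ 2 + 2) * ent μ (fun ω => (P ω, R ω))
    + (s ^ 2 / 2 + 3 * s / 2 + 1) * ent μ (fun ω => (Q ω, R ω))
    - (s ^ 2 + 1) * ent μ (fun ω => (P ω, Q ω, R ω))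

/-- Total weight of the cell of the partition `r` that contains `ω`. -/
noncomputable def cellMass {Ω : Type*} [Fintype Ω] (μ : Ω → ℝ) (r : Setoid Ω) (ω : Ω) : ℝ :=
  ∑ ω', if r ω' ω then μ ω' else 0

/-- Entropy of the partition `r` of the finite weighted space `(Ω, μ)`. -/
noncomputable def partEnt {Ω : Type*} [Fintype Ω] (μ : Ω → ℝ) (r : Setoid Ω) : ℝ :=
  -∑ ω, μ ω * Real.log (cellMass μ r ω)

section Partition

variable {Ω : Type*} [Fintype Ω] {μ : Ω → ℝ}

lemma cellMass_congr (r : Setoid Ω) {ω ω' : Ω} (h : r ω ω') :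
    cellMass μ r ω = cellMass μ r ω' := by
  unfold cellMass
  refine sum_congr rfl fun a _ => ?_
  have : r a ω ↔ r a ω' := ⟨fun k => r.trans k h, fun k => r.trans k (r.symm h)⟩
  simp only [this]

lemma le_cellMass (hμ : ∀ ω, 0 ≤ μ ω) (r : Setoid Ω) (ω : Ω) : μ ω ≤ cellMass μ r ω := by
  have := single_le_sum (f := fun ω' => if r ω' ω then μ ω' else 0)
    (fun i _ => by split_ifs <;> simp [hμ]) (mem_univ ω)
  simpa [cellMass, r.refl ω] using this

lemma cellMass_nonneg (hμ : ∀ ω, 0 ≤ μ ω) (r : Setoid Ω) (ω : Ω) : 0 ≤ cellMass μ r ω :=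
  (hμ ω).trans (le_cellMass hμ r ω)

lemma cellMass_pos (hμ : ∀ ω, 0 ≤ μ ω) (r : Setoid Ω) {ω : Ω} (h : μ ω ≠ 0) :
    0 < cellMass μ r ω :=
  ((hμ ω).lt_of_ne h.symm).trans_le (le_cellMass hμ r ω)

lemma cellMass_bot (ω : Ω) : cellMass μ ⊥ ω = μ ω := by
  simp [cellMass]

/-- The weights of one cell, divided by the mass of that cell, sum to at most one. -/
lemma sum_div_cellMass_le_one (x y : Setoid Ω) (ω₁ ω₂ : Ω) :
    (∑ ω, if x ω₁ ω ∧ y ω₂ ω then μ ω / cellMass μ (x ⊓ y) ω else 0) ≤ 1 := by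
  by_cases h : ∃ ω₀, x ω₁ ω₀ ∧ y ω₂ ω₀
  · obtain ⟨ω₀, h₁, h₂⟩ := h
    have key : ∀ ω, (if x ω₁ ω ∧ y ω₂ ω then μ ω / cellMass μ (x ⊓ y) ω else 0)
        = (if (x ⊓ y) ω ω₀ then μ ω else 0) / cellMass μ (x ⊓ y) ω₀ := by
      intro ω
      have e : (x ω₁ ω ∧ y ω₂ ω) ↔ (x ⊓ y) ω ω₀ :=
        ⟨fun k => ⟨x.trans (x.symm k.1) h₁, y.trans (y.symm k.2) h₂⟩,
          fun k => ⟨x.trans h₁ (x.symm k.1), y.trans h₂ (y.symm k.2)⟩⟩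
      by_cases k : (x ⊓ y) ω ω₀
      · rw [if_pos (e.2 k), if_pos k, cellMass_congr _ k]
      · rw [if_neg (mt e.1 k), if_neg k, zero_div]
    rw [sum_congr rfl fun ω _ => key ω, ← sum_div]
    exact div_self_le_one _
  · push Not at h
    rw [sum_eq_zero]
    · exact zero_le_one
    · intro ω _
      rw [if_neg]
      exact fun k => h ω k.1 k.2

lemma sum_cellMass_mul_div_le (hμ : ∀ ω, 0 ≤ μ ω) {x y v : Setoid Ω} (hx : x ≤ v) (hy : y ≤ v) :
    ∑ ω, μ ω * (cellMass μ x ω * cellMass μ y ω / (cellMass μ v ω * cellMass μ (x ⊓ y) ω))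
      ≤ ∑ ω, μ ω := by
  have expand : ∀ ω,
      μ ω * (cellMass μ x ω * cellMass μ y ω / (cellMass μ v ω * cellMass μ (x ⊓ y) ω))
        = ∑ ω₁, ∑ ω₂, (if v ω₂ ω₁ then μ ω₁ * μ ω₂ / cellMass μ v ω₁ else 0)
            * (if x ω₁ ω ∧ y ω₂ ω then μ ω / cellMass μ (x ⊓ y) ω else 0) := by
    intro ω
    have e : μ ω * (cellMass μ x ω * cellMass μ y ω / (cellMass μ v ω * cellMass μ (x ⊓ y) ω))
        = cellMass μ x ω * cellMass μ y ω * (μ ω / (cellMass μ v ω * cellMass μ (x ⊓ y) ω)) := by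
      ring
    rw [e]
    nth_rewrite 1 [cellMass]
    nth_rewrite 1 [cellMass]
    rw [sum_mul_sum, sum_mul]
    refine sum_congr rfl fun ω₁ _ => ?_
    rw [sum_mul]
    refine sum_congr rfl fun ω₂ _ => ?_
    by_cases k₁ : x ω₁ ω
    · by_cases k₂ : y ω₂ ω
      · have k : v ω₂ ω₁ := v.trans (hy k₂) (v.symm (hx k₁))
        rw [if_pos k₁, if_pos k₂, if_pos k, if_pos ⟨k₁, k₂⟩, cellMass_congr v (hx k₁),
          div_mul_div_comm, ← mul_div_assoc]
      · simp [k₂]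
    · simp [k₁]
  rw [sum_congr rfl fun ω _ => expand ω, sum_comm]
  refine sum_le_sum fun ω₁ _ => ?_
  rw [sum_comm]
  calc ∑ ω₂, ∑ ω, (if v ω₂ ω₁ then μ ω₁ * μ ω₂ / cellMass μ v ω₁ else 0)
            * (if x ω₁ ω ∧ y ω₂ ω then μ ω / cellMass μ (x ⊓ y) ω else 0)
      ≤ ∑ ω₂, (if v ω₂ ω₁ then μ ω₁ * μ ω₂ / cellMass μ v ω₁ else 0) := by
        refine sum_le_sum fun ω₂ _ => ?_
        rw [← mul_sum]
        refine mul_le_of_le_one_right ?_ (sum_div_cellMass_le_one x y ω₁ ω₂)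
        have := cellMass_nonneg hμ v ω₁
        have := hμ ω₁
        have := hμ ω₂
        split_ifs <;> positivity
    _ = μ ω₁ * (cellMass μ v ω₁ / cellMass μ v ω₁) := by
        nth_rewrite 2 [cellMass]
        rw [sum_div, mul_sum]
        refine sum_congr rfl fun ω₂ _ => ?_
        split_ifs <;> ring
    _ ≤ μ ω₁ := mul_le_of_le_one_right (hμ ω₁) (div_self_le_one _)

/-- Nonnegativity of conditional mutual information, for partitions. -/
theorem partEnt_submodular (hμ : ∀ ω, 0 ≤ μ ω) {x y v : Setoid Ω} (hx : x ≤ v) (hy : y ≤ v) :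
    partEnt μ (x ⊓ y) + partEnt μ v ≤ partEnt μ x + partEnt μ y := by
  have key : ∀ ω, μ ω * Real.log (cellMass μ x ω) + μ ω * Real.log (cellMass μ y ω)
      - μ ω * Real.log (cellMass μ v ω) - μ ω * Real.log (cellMass μ (x ⊓ y) ω)
      ≤ μ ω * (cellMass μ x ω * cellMass μ y ω / (cellMass μ v ω * cellMass μ (x ⊓ y) ω))
        - μ ω := by
    intro ω
    by_cases h : μ ω = 0
    · simp [h]
    have px := cellMass_pos hμ x h
    have py := cellMass_pos hμ y h
    have pv := cellMass_pos hμ v h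
    have pz := cellMass_pos hμ (x ⊓ y) h
    have hl := Real.log_le_sub_one_of_pos (div_pos (mul_pos px py) (mul_pos pv pz))
    rw [Real.log_div (mul_pos px py).ne' (mul_pos pv pz).ne', Real.log_mul px.ne' py.ne',
      Real.log_mul pv.ne' pz.ne'] at hl
    have := mul_le_mul_of_nonneg_left hl (hμ ω)
    linarith
  have hsum := sum_le_sum fun ω (_ : ω ∈ univ) => key ω
  simp only [sum_sub_distrib, sum_add_distrib] at hsum
  have := sum_cellMass_mul_div_le hμ hx hy
  unfold partEnt
  linarith

lemma partEnt_anti (hμ : ∀ ω, 0 ≤ μ ω) {x v : Setoid Ω} (h : x ≤ v) :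
    partEnt μ v ≤ partEnt μ x := by
  have := partEnt_submodular hμ h h
  rw [inf_idem] at this
  linarith

lemma partEnt_top (hμ1 : ∑ ω, μ ω = 1) : partEnt μ ⊤ = 0 := by
  simp [partEnt, cellMass, Setoid.top_def, hμ1]

end Partition

universe u

section Copy

lemma sum_pushforward {Ω Ω' : Type*} [Fintype Ω] [Fintype Ω'] {μ : Ω → ℝ} {μ' : Ω' → ℝ}
    {π : Ω' → Ω} (h : ∀ ω, ∑ p, (if π p = ω then μ' p else 0) = μ ω) (f : Ω → ℝ) :
    ∑ p, μ' p * f (π p) = ∑ ω, μ ω * f ω := by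
  simp_rw [← h, sum_mul, ite_mul, zero_mul]
  rw [sum_comm]
  simp

lemma partEnt_comap {Ω Ω' : Type*} [Fintype Ω] [Fintype Ω'] {μ : Ω → ℝ} {μ' : Ω' → ℝ}
    {π : Ω' → Ω} (h : ∀ ω, ∑ p, (if π p = ω then μ' p else 0) = μ ω) (r : Setoid Ω) :
    partEnt μ' (r.comap π) = partEnt μ r := by
  have hc : ∀ p, cellMass μ' (r.comap π) p = cellMass μ r (π p) := by
    intro p
    have := sum_pushforward h fun ω => if r ω (π p) then 1 else 0
    simpa [cellMass, Setoid.comap_rel] using this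
  unfold partEnt
  simp_rw [hc]
  rw [sum_pushforward h fun ω => Real.log (cellMass μ r ω)]

/-- Two copies of `(Ω, μ)` glued along the partition `v` so as to be conditionally independent
given `v`. -/
theorem exists_adhesive_copy {Ω : Type u} [Fintype Ω] {μ : Ω → ℝ} (hμ : ∀ ω, 0 ≤ μ ω)
    (v : Setoid Ω) :
    ∃ (Ω' : Type u) (_ : Fintype Ω') (μ' : Ω' → ℝ) (π₁ π₂ : Ω' → Ω),
      (∀ p, 0 ≤ μ' p) ∧
      (∀ r : Setoid Ω, partEnt μ' (r.comap π₁) = partEnt μ r) ∧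
      (∀ r : Setoid Ω, partEnt μ' (r.comap π₂) = partEnt μ r) ∧
      (∀ r : Setoid Ω, v ≤ r → r.comap π₁ = r.comap π₂) ∧
      ∀ a b : Setoid Ω,
        partEnt μ a + partEnt μ b ≤ partEnt μ' (a.comap π₁ ⊓ b.comap π₂) + partEnt μ v := by
  let Ω' : Type u := {p : Ω × Ω // v p.1 p.2}
  let μ' : Ω' → ℝ := fun p => μ p.1.1 * μ p.1.2 / cellMass μ v p.1.1
  let π₁ : Ω' → Ω := fun p => p.1.1
  let π₂ : Ω' → Ω := fun p => p.1.2
  have hμ' : ∀ p, 0 ≤ μ' p := fun p =>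
    div_nonneg (mul_nonneg (hμ _) (hμ _)) (cellMass_nonneg hμ _ _)
  have hsum : ∀ f : Ω × Ω → ℝ, ∑ p : Ω', f p.1 = ∑ ω₁, ∑ ω₂, if v ω₁ ω₂ then f (ω₁, ω₂) else 0 := by
    intro f
    rw [← Fintype.sum_prod_type' (f := fun ω₁ ω₂ => if v ω₁ ω₂ then f (ω₁, ω₂) else 0),
      ← sum_filter]
    exact (sum_subtype _ (by simp) f).symm
  have hcancel : ∀ ω, μ ω * (cellMass μ v ω / cellMass μ v ω) = μ ω := by
    intro ω
    by_cases h : μ ω = 0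
    · simp [h]
    · rw [div_self (cellMass_pos hμ v h).ne', mul_one]
  have hdiv : ∀ ω, cellMass μ v ω / cellMass μ v ω
      = ∑ ω', (if v ω' ω then μ ω' else 0) / cellMass μ v ω := fun ω => by
    rw [← sum_div]
    rfl
  have h₁ : ∀ ω, ∑ p, (if π₁ p = ω then μ' p else 0) = μ ω := by
    intro ω
    have e := hsum fun p => if p.1 = ω then μ p.1 * μ p.2 / cellMass μ v p.1 else 0
    refine e.trans ?_
    rw [sum_eq_single ω (fun b _ hb => by simp [hb]) (by simp), ← hcancel ω, hdiv ω, mul_sum]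
    refine sum_congr rfl fun ω₂ _ => ?_
    rw [Setoid.comm' v (x := ω) (y := ω₂)]
    split_ifs <;> simp_all [mul_div_assoc]
  have h₂ : ∀ ω, ∑ p, (if π₂ p = ω then μ' p else 0) = μ ω := by
    intro ω
    have e := hsum fun p => if p.2 = ω then μ p.1 * μ p.2 / cellMass μ v p.1 else 0
    refine e.trans ?_
    rw [sum_comm, sum_eq_single ω (fun b _ hb => by simp [hb]) (by simp), ← hcancel ω,
      hdiv ω, mul_sum]
    refine sum_congr rfl fun ω₁ _ => ?_
    by_cases k : v ω₁ ω
    · simp only [k, if_true, cellMass_congr v k]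
      ring
    · simp [k]
  have m₁ := partEnt_comap h₁
  have m₂ := partEnt_comap h₂
  have hv : ∀ r : Setoid Ω, v ≤ r → r.comap π₁ = r.comap π₂ := by
    intro r hr
    ext p q
    have hp : r (π₁ p) (π₂ p) := hr p.2
    have hq : r (π₁ q) (π₂ q) := hr q.2
    exact ⟨fun k => r.trans (r.symm hp) (r.trans k hq), fun k => r.trans hp (r.trans k (r.symm hq))⟩
  have hbot : Setoid.comap π₁ ⊥ ⊓ Setoid.comap π₂ ⊥ = (⊥ : Setoid Ω') := by
    refine le_antisymm (fun p q hpq => ?_) bot_le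
    exact Subtype.ext (Prod.ext hpq.1 hpq.2)
  have hfull : partEnt μ' ⊥ + partEnt μ v = partEnt μ ⊥ + partEnt μ ⊥ := by
    have s₁ := sum_pushforward h₁ fun ω => Real.log (μ ω)
    have s₂ := sum_pushforward h₂ fun ω => Real.log (μ ω)
    have s₃ := sum_pushforward h₁ fun ω => Real.log (cellMass μ v ω)
    have key : ∀ p, μ' p * Real.log (μ' p) = μ' p * Real.log (μ (π₁ p))
        + μ' p * Real.log (μ (π₂ p)) - μ' p * Real.log (cellMass μ v (π₁ p)) := by
      intro p
      by_cases h : μ' p = 0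
      · simp [h]
      have a : μ (π₁ p) ≠ 0 := fun k => h (by simp only [μ', π₁] at k ⊢; simp [k])
      have b : μ (π₂ p) ≠ 0 := fun k => h (by simp only [μ', π₂] at k ⊢; simp [k])
      have e : μ' p = μ (π₁ p) * μ (π₂ p) / cellMass μ v (π₁ p) := rfl
      nth_rewrite 2 [e]
      rw [Real.log_div (mul_ne_zero a b) (cellMass_pos hμ v a).ne', Real.log_mul a b]
      ring
    have hs := sum_congr rfl fun p (_ : p ∈ univ) => key p
    simp only [sum_sub_distrib, sum_add_distrib] at hs
    simp only [partEnt, cellMass_bot]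
    linarith
  refine ⟨Ω', inferInstance, μ', π₁, π₂, hμ', m₁, m₂, hv, fun a b => ?_⟩
  have hy : Setoid.comap π₂ ⊥ ≤ b.comap π₂ := fun p q h => (bot_le : ⊥ ≤ b) h
  have hx : Setoid.comap π₁ ⊥ ≤ a.comap π₁ := fun p q h => (bot_le : ⊥ ≤ a) h
  have s₁ := partEnt_submodular hμ' hx (inf_le_left : a.comap π₁ ⊓ Setoid.comap π₂ ⊥ ≤ _)
  have s₂ := partEnt_submodular hμ' (inf_le_right : a.comap π₁ ⊓ b.comap π₂ ≤ _) hy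
  rw [← inf_assoc, inf_eq_left.2 hx, hbot] at s₁
  rw [inf_assoc, inf_eq_right.2 hy] at s₂
  simp only [m₁, m₂] at s₁ s₂
  linarith

end Copy

section Polymatroid

/-- An instance of submodularity with the union and the intersection named explicitly. -/
lemma submodular_instance {ι : Type*} [DecidableEq ι] {h : Finset ι → ℝ}
    (hsub : ∀ S T, h (S ∪ T) + h (S ∩ T) ≤ h S + h T) (S T U W : Finset ι)
    (hU : S ∪ T = U := by decide) (hW : S ∩ T = W := by decide) :
    h U + h W ≤ h S + h T := by
  subst hU hW
  exact hsub S T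

/-- The Ingleton expression `I(2:3|0) + I(2:3|1) + I(0:1) - I(2:3)`. -/
def ingletonExpr (h : Finset (Fin 5) → ℝ) : ℝ :=
  h {0, 2} + h {0, 3} + h {1, 2} + h {1, 3} + h {2, 3} - h {0, 1} - h {2} - h {3}
    - h {0, 2, 3} - h {1, 2, 3}

/-- The expression `I(1:3|2) + I(2:3|1)`. -/
def doubleMarkovExpr (h : Finset (Fin 5) → ℝ) : ℝ :=
  2 * h {1, 2} + h {1, 3} + h {2, 3} - h {1} - h {2} - 2 * h {1, 2, 3}

/-- The expression `I(i:3|4) + I(3:4|i)`. -/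
def linkExpr (h : Finset (Fin 5) → ℝ) (i : Fin 5) : ℝ :=
  2 * h {i, 4} + h {3, 4} + h {i, 3} - h {4} - h {i} - 2 * h {i, 3, 4}

/-- The expression `I(i:4|3)`. -/
def residualExpr (h : Finset (Fin 5) → ℝ) (i : Fin 5) : ℝ :=
  h {i, 3} + h {3, 4} - h {3} - h {i, 3, 4}

lemma linkExpr_one_le {h : Finset (Fin 5) → ℝ}
    (hsub : ∀ S T, h (S ∪ T) + h (S ∩ T) ≤ h S + h T)
    (hci : h {0, 1, 2, 3} + h {2, 3, 4} ≤ h {0, 1, 2, 3, 4} + h {2, 3}) :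
    linkExpr h 1 ≤ linkExpr h 2 + doubleMarkovExpr h := by
  unfold linkExpr doubleMarkovExpr
  linarith [submodular_instance hsub {1, 2, 4} {1, 3, 4} {1, 2, 3, 4} {1, 4},
    submodular_instance hsub {1, 2} {2, 4} {1, 2, 4} {2},
    submodular_instance hsub {0, 1, 2, 3} {1, 2, 3, 4} {0, 1, 2, 3, 4} {1, 2, 3}]

lemma linkExpr_two_le {h : Finset (Fin 5) → ℝ}
    (hsub : ∀ S T, h (S ∪ T) + h (S ∩ T) ≤ h S + h T)
    (hci : h {0, 1, 2, 3} + h {1, 3, 4} ≤ h {0, 1, 2, 3, 4} + h {1, 3}) :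
    linkExpr h 2 ≤ linkExpr h 1 + doubleMarkovExpr h := by
  unfold linkExpr doubleMarkovExpr
  linarith [submodular_instance hsub {1, 2, 4} {2, 3, 4} {1, 2, 3, 4} {2, 4},
    submodular_instance hsub {1, 2} {1, 4} {1, 2, 4} {1},
    submodular_instance hsub {0, 1, 2, 3} {1, 2, 3, 4} {0, 1, 2, 3, 4} {1, 2, 3}]

lemma residualExpr_one_le {h : Finset (Fin 5) → ℝ}
    (hsub : ∀ S T, h (S ∪ T) + h (S ∩ T) ≤ h S + h T)
    (hci : h {0, 1, 2, 3} + h {2, 3, 4} ≤ h {0, 1, 2, 3, 4} + h {2, 3}) :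
    residualExpr h 1 ≤ ingletonExpr h + linkExpr h 2 + residualExpr h 2 := by
  unfold linkExpr ingletonExpr residualExpr
  linarith [submodular_instance hsub {1, 2, 4} {1, 3, 4} {1, 2, 3, 4} {1, 4},
    submodular_instance hsub {0, 3} {3, 4} {0, 3, 4} {3},
    submodular_instance hsub {1, 2} {2, 4} {1, 2, 4} {2},
    submodular_instance hsub {0, 4} {1, 4} {0, 1, 4} {4},
    submodular_instance hsub {0, 1, 3} {0, 1, 4} {0, 1, 3, 4} {0, 1},
    submodular_instance hsub {0, 1, 2, 3} {1, 2, 3, 4} {0, 1, 2, 3, 4} {1, 2, 3},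
    submodular_instance hsub {0, 2, 4} {0, 3, 4} {0, 2, 3, 4} {0, 4},
    submodular_instance hsub {0, 2} {2, 4} {0, 2, 4} {2},
    submodular_instance hsub {0, 1, 2, 3} {0, 2, 3, 4} {0, 1, 2, 3, 4} {0, 2, 3},
    submodular_instance hsub {0, 1, 2, 3} {0, 1, 3, 4} {0, 1, 2, 3, 4} {0, 1, 3}]

lemma residualExpr_two_le {h : Finset (Fin 5) → ℝ}
    (hsub : ∀ S T, h (S ∪ T) + h (S ∩ T) ≤ h S + h T)
    (hci : h {0, 1, 2, 3} + h {1, 3, 4} ≤ h {0, 1, 2, 3, 4} + h {1, 3}) :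
    residualExpr h 2 ≤ ingletonExpr h + linkExpr h 1 + residualExpr h 1 := by
  unfold linkExpr ingletonExpr residualExpr
  linarith [submodular_instance hsub {1, 2} {1, 4} {1, 2, 4} {1},
    submodular_instance hsub {0, 4} {1, 4} {0, 1, 4} {4},
    submodular_instance hsub {0, 1, 2, 3} {0, 2, 3, 4} {0, 1, 2, 3, 4} {0, 2, 3},
    submodular_instance hsub {0, 1, 2, 3} {0, 1, 2, 4} {0, 1, 2, 3, 4} {0, 1, 2},
    submodular_instance hsub {0, 1, 2, 3} {1, 2, 3, 4} {0, 1, 2, 3, 4} {1, 2, 3},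
    submodular_instance hsub {0, 3} {3, 4} {0, 3, 4} {3},
    submodular_instance hsub {0, 2} {2, 4} {0, 2, 4} {2},
    submodular_instance hsub {0, 1, 2} {0, 1, 4} {0, 1, 2, 4} {0, 1},
    submodular_instance hsub {0, 2, 4} {0, 3, 4} {0, 2, 3, 4} {0, 4},
    submodular_instance hsub {1, 2, 4} {2, 3, 4} {1, 2, 3, 4} {2, 4}]

end Polymatroid

section Triangle

lemma triangle_condIndep {h : Finset (Fin 6) → ℝ}
    (hsub : ∀ S T, h (S ∪ T) + h (S ∩ T) ≤ h S + h T) (hempty : h ∅ = 0)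
    (htri : h {3} + h {4} + h {5} + (h {0, 3, 5} - h {3, 5}) + (h {1, 4, 5} - h {4, 5})
      + (h {2, 3, 4} - h {3, 4}) ≤ h {0, 1, 2, 3, 4, 5}) :
    h {0, 5} + h {1, 5} ≤ h {0, 1, 5} + h {5} := by
  linarith [submodular_instance hsub {0, 1, 3, 4, 5} {2, 3, 4} {0, 1, 2, 3, 4, 5} {3, 4},
    submodular_instance hsub {1, 4, 5} {0, 1, 3, 5} {0, 1, 3, 4, 5} {1, 5},
    submodular_instance hsub {4} {5} {4, 5} ∅,
    submodular_instance hsub {3} {5} {3, 5} ∅,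
    submodular_instance hsub {0, 3, 5} {0, 1, 5} {0, 1, 3, 5} {0, 5}]

lemma triangle_indep {h : Finset (Fin 6) → ℝ}
    (hsub : ∀ S T, h (S ∪ T) + h (S ∩ T) ≤ h S + h T) (hempty : h ∅ = 0)
    (htri : h {3} + h {4} + h {5} + (h {0, 3, 5} - h {3, 5}) + (h {1, 4, 5} - h {4, 5})
      + (h {2, 3, 4} - h {3, 4}) ≤ h {0, 1, 2, 3, 4, 5}) :
    h {2} + h {5} ≤ h {2, 5} := by
  linarith [submodular_instance hsub {2, 3, 4} {2, 5} {2, 3, 4, 5} {2},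
    submodular_instance hsub {0, 3, 5} {2, 3, 4, 5} {0, 2, 3, 4, 5} {3, 5},
    submodular_instance hsub {3} {4} {3, 4} ∅,
    submodular_instance hsub {0, 2, 3, 4, 5} {1, 4, 5} {0, 1, 2, 3, 4, 5} {4, 5}]

lemma triangle_slack_nonneg {h : Finset (Fin 6) → ℝ}
    (hsub : ∀ S T, h (S ∪ T) + h (S ∩ T) ≤ h S + h T) (hempty : h ∅ = 0)
    (htri : h {3} + h {4} + h {5} + (h {0, 3, 5} - h {3, 5}) + (h {1, 4, 5} - h {4, 5})
      + (h {2, 3, 4} - h {3, 4}) ≤ h {0, 1, 2, 3, 4, 5})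
    (hmono : ∀ S T, S ⊆ T → h S ≤ h T) :
    h {1} + h {5} + h {2} ≤ h {1, 5} + h {1, 2} := by
  have hm := hmono {0, 2, 3, 4, 5} {0, 1, 2, 3, 4, 5} (by decide)
  linarith [submodular_instance hsub {1, 5} {1, 2} {1, 2, 5} {1},
    submodular_instance hsub {0, 3, 5} {1, 2, 3, 4, 5} {0, 1, 2, 3, 4, 5} {3, 5},
    submodular_instance hsub {0, 2, 3, 4, 5} {1, 4, 5} {0, 1, 2, 3, 4, 5} {4, 5},
    submodular_instance hsub {3} {4} {3, 4} ∅,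
    submodular_instance hsub {2, 3, 4} {1, 2, 5} {1, 2, 3, 4, 5} {2}]

lemma triangle_slack_add_nonneg {h : Finset (Fin 6) → ℝ}
    (hsub : ∀ S T, h (S ∪ T) + h (S ∩ T) ≤ h S + h T) (hempty : h ∅ = 0)
    (htri : h {3} + h {4} + h {5} + (h {0, 3, 5} - h {3, 5}) + (h {1, 4, 5} - h {4, 5})
      + (h {2, 3, 4} - h {3, 4}) ≤ h {0, 1, 2, 3, 4, 5})
    (hmono : ∀ S T, S ⊆ T → h S ≤ h T) :
    2 * h {0} + 2 * h {1} + 3 * h {2} + 2 * h {5} + h {0, 1, 2}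
      ≤ h {1, 5} + 2 * h {1, 2} + h {0, 5} + 2 * h {0, 2} + h {0, 1} := by
  have hm := hmono {2, 3, 4, 5} {0, 1, 2, 3, 4, 5} (by decide)
  linarith [submodular_instance hsub {1, 4} {0, 1} {0, 1, 4} {1},
    submodular_instance hsub {2, 3, 4} {1, 2} {1, 2, 3, 4} {2},
    submodular_instance hsub {3} {4} {3, 4} ∅,
    submodular_instance hsub {0, 2, 5} {1, 2, 5} {0, 1, 2, 5} {2, 5},
    submodular_instance hsub {0, 1, 4} {0, 2, 3, 4} {0, 1, 2, 3, 4} {0, 4},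
    submodular_instance hsub {1, 4, 5} {1, 2, 3, 4} {1, 2, 3, 4, 5} {1, 4},
    submodular_instance hsub {1, 5} {1, 2} {1, 2, 5} {1},
    submodular_instance hsub {0, 3, 5} {0, 4} {0, 3, 4, 5} {0},
    submodular_instance hsub {2, 3, 4} {0, 2} {0, 2, 3, 4} {2},
    submodular_instance hsub {0, 3, 4, 5} {1, 4, 5} {0, 1, 3, 4, 5} {4, 5},
    submodular_instance hsub {0, 1, 2, 3, 4} {0, 1, 2, 5} {0, 1, 2, 3, 4, 5} {0, 1, 2},
    submodular_instance hsub {2, 3, 4} {2, 5} {2, 3, 4, 5} {2},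
    submodular_instance hsub {0, 5} {0, 2} {0, 2, 5} {0},
    submodular_instance hsub {0, 3, 5} {1, 2, 3, 4, 5} {0, 1, 2, 3, 4, 5} {3, 5},
    submodular_instance hsub {4} {5} {4, 5} ∅,
    submodular_instance hsub {0, 1, 3, 4, 5} {2, 3, 4} {0, 1, 2, 3, 4, 5} {3, 4},
    submodular_instance hsub {1, 4, 5} {2, 3, 4, 5} {1, 2, 3, 4, 5} {4, 5},
    submodular_instance hsub {3} {5} {3, 5} ∅]

end Triangle

section JointEntropy

/-- Joint entropy of the partitions `V i`, `i ∈ S`. -/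
noncomputable def jointEnt {Ω ι : Type*} [Fintype Ω] (μ : Ω → ℝ) (V : ι → Setoid Ω)
    (S : Finset ι) : ℝ :=
  partEnt μ (S.inf V)

variable {Ω ι : Type*} [Fintype Ω] {μ : Ω → ℝ}

lemma jointEnt_submodular [DecidableEq ι] (hμ : ∀ ω, 0 ≤ μ ω) (V : ι → Setoid Ω) (S T : Finset ι) :
    jointEnt μ V (S ∪ T) + jointEnt μ V (S ∩ T) ≤ jointEnt μ V S + jointEnt μ V T := by
  unfold jointEnt
  rw [inf_union]
  exact partEnt_submodular hμ (inf_mono inter_subset_left) (inf_mono inter_subset_right)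

lemma jointEnt_mono (hμ : ∀ ω, 0 ≤ μ ω) (V : ι → Setoid Ω) (S T : Finset ι) (h : S ⊆ T) :
    jointEnt μ V S ≤ jointEnt μ V T :=
  partEnt_anti hμ (inf_mono h)

lemma comap_finset_inf {Ω Ω' ι : Type*} [DecidableEq ι] (π : Ω' → Ω) (V : ι → Setoid Ω)
    (S : Finset ι) :
    (S.inf V).comap π = S.inf fun i => (V i).comap π := by
  induction S using Finset.induction_on with
  | empty => rfl
  | insert i S _ ih =>
    rw [inf_insert, inf_insert, ← ih]
    rfl

/-- The variable `4` can be made conditionally independent of the variables `0`, `1`, `2`, `3`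
given `i` and `3`, without changing its joint law with `i` and `3`. -/
theorem exists_jointEnt_copy {Ω : Type u} [Fintype Ω] {μ : Ω → ℝ} (hμ : ∀ ω, 0 ≤ μ ω)
    (V : Fin 5 → Setoid Ω) (i : Fin 5) :
    ∃ (Ω' : Type u) (_ : Fintype Ω') (μ' : Ω' → ℝ) (V' : Fin 5 → Setoid Ω'),
      (∀ p, 0 ≤ μ' p) ∧
      (∀ S, 4 ∉ S → jointEnt μ' V' S = jointEnt μ V S) ∧
      (∀ S, S ⊆ {i, 3, 4} → jointEnt μ' V' S = jointEnt μ V S) ∧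
      jointEnt μ V {0, 1, 2, 3} + jointEnt μ V {i, 3, 4}
        ≤ jointEnt μ' V' ({0, 1, 2, 3} ∪ {i, 3, 4}) + jointEnt μ V {i, 3} := by
  obtain ⟨Ω', _, μ', π₁, π₂, hμ', h₁, h₂, hv, hci⟩ :=
    exists_adhesive_copy hμ (({i, 3} : Finset (Fin 5)).inf V)
  let V' : Fin 5 → Setoid Ω' := fun j => if j = 4 then (V j).comap π₂ else (V j).comap π₁
  have e₁ : ∀ S : Finset (Fin 5), 4 ∉ S → S.inf V' = (S.inf V).comap π₁ := by
    intro S hS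
    rw [comap_finset_inf]
    refine inf_congr rfl fun j hj => if_neg ?_
    rintro rfl
    exact hS hj
  have e₂ : ∀ S : Finset (Fin 5), S ⊆ {i, 3, 4} → S.inf V' = (S.inf V).comap π₂ := by
    intro S hS
    rw [comap_finset_inf]
    refine inf_congr rfl fun j hj => ?_
    by_cases h4 : j = 4
    · exact if_pos h4
    · refine (if_neg h4).trans (hv _ (inf_le ?_))
      have := hS hj
      simp only [mem_insert, mem_singleton] at this ⊢
      tauto
  refine ⟨Ω', inferInstance, μ', V', hμ', fun S hS => ?_, fun S hS => ?_, ?_⟩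
  · rw [jointEnt, e₁ S hS, h₁, jointEnt]
  · rw [jointEnt, e₂ S hS, h₂, jointEnt]
  · have := hci (({0, 1, 2, 3} : Finset (Fin 5)).inf V) (({i, 3, 4} : Finset (Fin 5)).inf V)
    rw [← e₁ _ (by decide), ← e₂ _ Subset.rfl, ← inf_union] at this
    exact this

/-- **Matúš inequalities** for five random variables. -/
theorem matus_inequality (s : ℕ) : ∀ {Ω : Type u} [Fintype Ω] {μ : Ω → ℝ} (_ : ∀ ω, 0 ≤ μ ω)
    (V : Fin 5 → Setoid Ω) (i : Fin 5) (_ : i = 1 ∨ i = 2),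
    0 ≤ s * (ingletonExpr (jointEnt μ V) + linkExpr (jointEnt μ V) i)
      + residualExpr (jointEnt μ V) i
      + (s * (s - 1) / 2 : ℝ) * doubleMarkovExpr (jointEnt μ V) := by
  induction s with
  | zero =>
    intro Ω _ μ hμ V i hi
    have hsub := jointEnt_submodular hμ V
    simp only [residualExpr, Nat.cast_zero, zero_mul, zero_div, zero_add, add_zero]
    rcases hi with rfl | rfl
    · linarith [submodular_instance hsub {1, 3} {3, 4} {1, 3, 4} {3}]
    · linarith [submodular_instance hsub {2, 3} {3, 4} {2, 3, 4} {3}]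
  | succ s ih =>
    intro Ω _ μ hμ V i hi
    obtain ⟨Ω', _, μ', V', hμ', h₁, h₂, hci⟩ := exists_jointEnt_copy hμ V i
    have hsub := jointEnt_submodular hμ' V'
    have eI : ingletonExpr (jointEnt μ' V') = ingletonExpr (jointEnt μ V) := by
      unfold ingletonExpr
      repeat rw [h₁ _ (by decide)]
    have eD : doubleMarkovExpr (jointEnt μ' V') = doubleMarkovExpr (jointEnt μ V) := by
      unfold doubleMarkovExpr
      repeat rw [h₁ _ (by decide)]
    have eL : linkExpr (jointEnt μ' V') i = linkExpr (jointEnt μ V) i := by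
      unfold linkExpr
      rcases hi with rfl | rfl <;> repeat rw [h₂ _ (by decide)]
    have eR : residualExpr (jointEnt μ' V') i = residualExpr (jointEnt μ V) i := by
      unfold residualExpr
      rcases hi with rfl | rfl <;> repeat rw [h₂ _ (by decide)]
    rw [← h₁ _ (by decide), ← h₂ _ Subset.rfl,
      ← h₂ {i, 3} (by rcases hi with rfl | rfl <;> decide)] at hci
    rw [← eI, ← eD, ← eL, ← eR]
    clear eI eD eL eR
    push_cast
    rcases hi with rfl | rfl
    · rw [show ({0, 1, 2, 3} ∪ {1, 3, 4} : Finset (Fin 5)) = {0, 1, 2, 3, 4} by decide] at hci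
      linear_combination ih hμ' V' 2 (Or.inr rfl) + residualExpr_two_le hsub hci
        + (s : ℝ) * linkExpr_two_le hsub hci
    · rw [show ({0, 1, 2, 3} ∪ {2, 3, 4} : Finset (Fin 5)) = {0, 1, 2, 3, 4} by decide] at hci
      linear_combination ih hμ' V' 1 (Or.inl rfl) + residualExpr_one_le hsub hci
        + (s : ℝ) * linkExpr_one_le hsub hci

/-- The marginal inequality for partitions: `p`, `q`, `r` are observed, and the hidden variables
`a`, `b`, `c` are shared by the pairs `{p, r}`, `{q, r}`, `{p, q}` respectively. -/
theorem triangle_marginal_inequality {Ω : Type u} [Fintype Ω] {μ : Ω → ℝ} (hμ : ∀ ω, 0 ≤ μ ω)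
    (hμ1 : ∑ ω, μ ω = 1) (p q r a b c : Setoid Ω)
    (htri : partEnt μ a + partEnt μ b + partEnt μ c
      + (partEnt μ (p ⊓ (a ⊓ c)) - partEnt μ (a ⊓ c))
      + (partEnt μ (q ⊓ (b ⊓ c)) - partEnt μ (b ⊓ c))
      + (partEnt μ (r ⊓ (a ⊓ b)) - partEnt μ (a ⊓ b))
      ≤ partEnt μ (p ⊓ (q ⊓ (r ⊓ (a ⊓ (b ⊓ c))))))
    (s : ℕ) (hs : 1 ≤ s) :
    0 ≤ (-((s : ℝ) ^ 2) / 2 - 3 * s / 2 - 2) * (partEnt μ p + partEnt μ r - partEnt μ (p ⊓ q))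
      - (2 * s + 2) * partEnt μ q + ((s : ℝ) ^ 2 + 2) * partEnt μ (p ⊓ r)
      + ((s : ℝ) ^ 2 / 2 + 3 * s / 2 + 1) * partEnt μ (q ⊓ r)
      - ((s : ℝ) ^ 2 + 1) * partEnt μ (p ⊓ (q ⊓ r)) := by
  have hsub := jointEnt_submodular hμ ![p, q, r, a, b, c]
  have hmono := jointEnt_mono hμ ![p, q, r, a, b, c]
  have hempty : jointEnt μ ![p, q, r, a, b, c] ∅ = 0 := by simp [jointEnt, partEnt_top hμ1]
  have c₁ := triangle_condIndep hsub hempty (by simpa [jointEnt] using htri)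
  have c₂ := triangle_indep hsub hempty (by simpa [jointEnt] using htri)
  have c₃ := triangle_slack_nonneg hsub hempty (by simpa [jointEnt] using htri) hmono
  have c₄ := triangle_slack_add_nonneg hsub hempty (by simpa [jointEnt] using htri) hmono
  have key := matus_inequality s hμ ![c, r, p, q, c] 2 (Or.inr rfl)
  have hs' : (1 : ℝ) ≤ s := by exact_mod_cast hs
  simp only [ingletonExpr, linkExpr, residualExpr, doubleMarkovExpr] at key
  simp [jointEnt] at c₁ c₂ c₃ c₄ key
  rw [inf_comm c (p ⊓ q), inf_comm r (p ⊓ q), inf_assoc p q c, inf_assoc p q r, inf_comm c p,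
    inf_comm c q, inf_comm r p, inf_comm r q, inf_comm c r] at key
  linear_combination key + (3 * (s : ℝ) + 1) * c₁ + (s : ℝ) * c₂
    + mul_le_mul_of_nonneg_left c₃ (sub_nonneg.2 hs') + c₄

end JointEntropy

section Bridge

variable {Ω : Type*} [Fintype Ω] {μ : Ω → ℝ}

lemma cellMass_ker {β : Type*} (X : Ω → β) (ω : Ω) :
    cellMass μ (Setoid.ker X) ω = pr μ X (X ω) := by
  simp only [cellMass, pr, Setoid.ker_def]

lemma ent_eq_partEnt {β : Type*} [Fintype β] (X : Ω → β) :
    ent μ X = partEnt μ (Setoid.ker X) := by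
  have := sum_pushforward (μ := pr μ X) (μ' := μ) (π := X) (fun _ => rfl)
    fun b => Real.log (pr μ X b)
  simp only [partEnt, cellMass_ker, this, ent, Real.negMulLog, neg_mul, sum_neg_distrib]

lemma ker_prodMk {Ω β γ : Type*} (X : Ω → β) (Y : Ω → γ) :
    Setoid.ker (fun ω => (X ω, Y ω)) = Setoid.ker X ⊓ Setoid.ker Y := by
  ext a b
  simp [Setoid.ker_def, Setoid.inf_def]

/-- **Gibbs' inequality**, conditional form: `H(X | W)` is at most the cross entropy of the law of
`X` given `W` relative to any conditional law `q`. -/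
lemma condEnt_le_crossEnt {β γ : Type*} [Fintype β] [Fintype γ] (hμ : ∀ ω, 0 ≤ μ ω)
    (X : Ω → β) (W : Ω → γ) (q : β → γ → ℝ) (hq : ∀ x w, 0 ≤ q x w)
    (hq1 : ∀ w, ∑ x, q x w = 1) (hpos : ∀ ω, μ ω ≠ 0 → q (X ω) (W ω) ≠ 0) :
    partEnt μ (Setoid.ker X ⊓ Setoid.ker W) - partEnt μ (Setoid.ker W)
      ≤ -∑ ω, μ ω * Real.log (q (X ω) (W ω)) := by
  have hpr : ∀ w, 0 ≤ pr μ W w := fun w =>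
    sum_nonneg fun ω _ => by split_ifs <;> simp [hμ]
  let J : Ω → β × γ := fun ω => (X ω, W ω)
  have key : ∀ ω, μ ω * Real.log (q (X ω) (W ω)) + μ ω * Real.log (pr μ W (W ω))
      - μ ω * Real.log (pr μ J (J ω))
      ≤ μ ω * (q (X ω) (W ω) * pr μ W (W ω) / pr μ J (J ω)) - μ ω := by
    intro ω
    by_cases h : μ ω = 0
    · simp [h]
    have p₁ : 0 < q (X ω) (W ω) := (hq _ _).lt_of_ne (hpos ω h).symm
    have p₂ : 0 < pr μ W (W ω) := cellMass_ker (μ := μ) W ω ▸ cellMass_pos hμ _ h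
    have p₃ : 0 < pr μ J (J ω) := cellMass_ker (μ := μ) J ω ▸ cellMass_pos hμ _ h
    have hl := Real.log_le_sub_one_of_pos (div_pos (mul_pos p₁ p₂) p₃)
    rw [Real.log_div (mul_pos p₁ p₂).ne' p₃.ne', Real.log_mul p₁.ne' p₂.ne'] at hl
    linarith [mul_le_mul_of_nonneg_left hl (hμ ω)]
  have hsum := sum_le_sum fun ω (_ : ω ∈ univ) => key ω
  simp only [sum_sub_distrib, sum_add_distrib] at hsum
  have hpush := sum_pushforward (μ := pr μ J) (μ' := μ) (π := J) (fun _ => rfl)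
    fun d => q d.1 d.2 * pr μ W d.2 / pr μ J d
  have hW := sum_pushforward (μ := pr μ W) (μ' := μ) (π := W) (fun _ => rfl) fun _ => 1
  have hle : ∑ d, pr μ J d * (q d.1 d.2 * pr μ W d.2 / pr μ J d) ≤ ∑ w, pr μ W w * 1 := by
    calc _ ≤ ∑ d : β × γ, q d.1 d.2 * pr μ W d.2 := by
          refine sum_le_sum fun d _ => ?_
          rw [mul_div_left_comm]
          exact mul_le_of_le_one_right (mul_nonneg (hq _ _) (hpr _)) (div_self_le_one _)
      _ = _ := by
          rw [Fintype.sum_prod_type_right]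
          refine sum_congr rfl fun w _ => ?_
          simp only [← sum_mul, hq1, one_mul, mul_one]
  rw [← hpush, ← hW] at hle
  simp only [mul_one] at hle
  rw [← ker_prodMk]
  simp only [partEnt, cellMass_ker]
  simp only [J] at hsum hle
  linarith

/-- Gibbs' inequality: entropy is at most cross entropy. -/
lemma partEnt_le_crossEnt {β : Type*} [Fintype β] (hμ : ∀ ω, 0 ≤ μ ω) (hμ1 : ∑ ω, μ ω = 1)
    (X : Ω → β) (q : β → ℝ) (hq : ∀ x, 0 ≤ q x) (hq1 : ∑ x, q x = 1)
    (hpos : ∀ ω, μ ω ≠ 0 → q (X ω) ≠ 0) :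
    partEnt μ (Setoid.ker X) ≤ -∑ ω, μ ω * Real.log (q (X ω)) := by
  have := condEnt_le_crossEnt hμ X (fun _ => ()) (fun x _ => q x) (fun x _ => hq x)
    (fun _ => hq1) hpos
  have htop : Setoid.ker (fun _ : Ω => ()) = ⊤ := by
    ext
    simp [Setoid.ker_def, Setoid.top_def]
  rwa [htop, inf_top_eq, partEnt_top hμ1, sub_zero] at this

/-- A distribution compatible with the triangle causal structure satisfies the entropic form of
the Markov factorization. -/
lemma triangle_entropy_le {SX SY SZ SA SB SC : Type*} [Fintype SX] [Fintype SY] [Fintype SZ]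
    [Fintype SA] [Fintype SB] [Fintype SC]
    (hμ0 : ∀ ω, 0 ≤ μ ω) (hμ1 : ∑ ω, μ ω = 1)
    (X : Ω → SX) (Y : Ω → SY) (Z : Ω → SZ) (A : Ω → SA) (B : Ω → SB) (C : Ω → SC)
    (pA : SA → ℝ) (pB : SB → ℝ) (pC : SC → ℝ)
    (qX : SX → SB → SC → ℝ) (qY : SY → SA → SC → ℝ) (qZ : SZ → SA → SB → ℝ)
    (hpA0 : ∀ a, 0 ≤ pA a) (hpA1 : ∑ a, pA a = 1)
    (hpB0 : ∀ b, 0 ≤ pB b) (hpB1 : ∑ b, pB b = 1)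
    (hpC0 : ∀ c, 0 ≤ pC c) (hpC1 : ∑ c, pC c = 1)
    (hqX0 : ∀ x b c, 0 ≤ qX x b c) (hqX1 : ∀ b c, ∑ x, qX x b c = 1)
    (hqY0 : ∀ y a c, 0 ≤ qY y a c) (hqY1 : ∀ a c, ∑ y, qY y a c = 1)
    (hqZ0 : ∀ z a b, 0 ≤ qZ z a b) (hqZ1 : ∀ a b, ∑ z, qZ z a b = 1)
    (hfact : ∀ x y z a b c,
      pr μ (fun ω => (X ω, Y ω, Z ω, A ω, B ω, C ω)) (x, y, z, a, b, c)
        = pA a * pB b * pC c * qX x b c * qY y a c * qZ z a b) :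
    partEnt μ (.ker A) + partEnt μ (.ker B) + partEnt μ (.ker C)
      + (partEnt μ (.ker X ⊓ (.ker B ⊓ .ker C)) - partEnt μ (.ker B ⊓ .ker C))
      + (partEnt μ (.ker Y ⊓ (.ker A ⊓ .ker C)) - partEnt μ (.ker A ⊓ .ker C))
      + (partEnt μ (.ker Z ⊓ (.ker A ⊓ .ker B)) - partEnt μ (.ker A ⊓ .ker B))
      ≤ partEnt μ (.ker X ⊓ (.ker Y ⊓ (.ker Z ⊓ (.ker A ⊓ (.ker B ⊓ .ker C))))) := by
  have hne : ∀ ω, μ ω ≠ 0 → pA (A ω) * pB (B ω) * pC (C ω) * qX (X ω) (B ω) (C ω)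
      * qY (Y ω) (A ω) (C ω) * qZ (Z ω) (A ω) (B ω) ≠ 0 := by
    intro ω h
    rw [← hfact, ← cellMass_ker (fun ω => (X ω, Y ω, Z ω, A ω, B ω, C ω)) ω]
    exact (cellMass_pos hμ0 _ h).ne'
  simp only [mul_ne_zero_iff, and_assoc] at hne
  have gA := partEnt_le_crossEnt hμ0 hμ1 A pA hpA0 hpA1 fun ω h => (hne ω h).1
  have gB := partEnt_le_crossEnt hμ0 hμ1 B pB hpB0 hpB1 fun ω h => (hne ω h).2.1
  have gC := partEnt_le_crossEnt hμ0 hμ1 C pC hpC0 hpC1 fun ω h => (hne ω h).2.2.1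
  have gX := condEnt_le_crossEnt hμ0 X (fun ω => (B ω, C ω)) (fun x w => qX x w.1 w.2)
    (fun _ _ => hqX0 _ _ _) (fun _ => hqX1 _ _) fun ω h => (hne ω h).2.2.2.1
  have gY := condEnt_le_crossEnt hμ0 Y (fun ω => (A ω, C ω)) (fun x w => qY x w.1 w.2)
    (fun _ _ => hqY0 _ _ _) (fun _ => hqY1 _ _) fun ω h => (hne ω h).2.2.2.2.1
  have gZ := condEnt_le_crossEnt hμ0 Z (fun ω => (A ω, B ω)) (fun x w => qZ x w.1 w.2)
    (fun _ _ => hqZ0 _ _ _) (fun _ => hqZ1 _ _) fun ω h => (hne ω h).2.2.2.2.2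
  have hall : partEnt μ (Setoid.ker fun ω => (X ω, Y ω, Z ω, A ω, B ω, C ω))
      = -∑ ω, (μ ω * Real.log (pA (A ω)) + μ ω * Real.log (pB (B ω))
        + μ ω * Real.log (pC (C ω)) + μ ω * Real.log (qX (X ω) (B ω) (C ω))
        + μ ω * Real.log (qY (Y ω) (A ω) (C ω)) + μ ω * Real.log (qZ (Z ω) (A ω) (B ω))) := by
    simp only [partEnt, cellMass_ker, hfact]
    refine congrArg Neg.neg (sum_congr rfl fun ω _ => ?_)
    by_cases h : μ ω = 0
    · simp [h]
    obtain ⟨nA, nB, nC, nX, nY, nZ⟩ := hne ω h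
    rw [Real.log_mul (by simp [*]) nZ, Real.log_mul (by simp [*]) nY,
      Real.log_mul (by simp [*]) nX, Real.log_mul (by simp [*]) nC, Real.log_mul nA nB]
    ring
  simp only [ker_prodMk, sum_add_distrib] at gX gY gZ hall
  linarith

lemma matusMarg3_iff {β γ δ : Type*} [Fintype β] [Fintype γ] [Fintype δ] (s : ℝ)
    (P : Ω → β) (Q : Ω → γ) (R : Ω → δ) :
    matusMarg3 s μ P Q R ↔
      0 ≤ (-(s ^ 2) / 2 - 3 * s / 2 - 2)
          * (partEnt μ (.ker P) + partEnt μ (.ker R) - partEnt μ (.ker P ⊓ .ker Q))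
        - (2 * s + 2) * partEnt μ (.ker Q) + (s ^ 2 + 2) * partEnt μ (.ker P ⊓ .ker R)
        + (s ^ 2 / 2 + 3 * s / 2 + 1) * partEnt μ (.ker Q ⊓ .ker R)
        - (s ^ 2 + 1) * partEnt μ (.ker P ⊓ (.ker Q ⊓ .ker R)) := by
  simp only [matusMarg3, ent_eq_partEnt, ker_prodMk]

end Bridge

/-- **Proposition 4, family (16).** For every distribution compatible with the classical
triangle causal structure and every integer `s ≥ 1`, the inequality `matusMarg3` holds
for `(X, Y, Z)` and all permutations of the roles of `X`, `Y` and `Z`. -/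
theorem triangle_matus_marg3
    {Ω SX SY SZ SA SB SC : Type*} [Fintype Ω] [Fintype SX] [Fintype SY] [Fintype SZ]
    [Fintype SA] [Fintype SB] [Fintype SC]
    (μ : Ω → ℝ) (hμ0 : ∀ ω, 0 ≤ μ ω) (hμ1 : ∑ ω, μ ω = 1)
    (X : Ω → SX) (Y : Ω → SY) (Z : Ω → SZ) (A : Ω → SA) (B : Ω → SB) (C : Ω → SC)
    (pA : SA → ℝ) (pB : SB → ℝ) (pC : SC → ℝ)
    (qX : SX → SB → SC → ℝ) (qY : SY → SA → SC → ℝ) (qZ : SZ → SA → SB → ℝ)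
    (hpA0 : ∀ a, 0 ≤ pA a) (hpA1 : ∑ a, pA a = 1)
    (hpB0 : ∀ b, 0 ≤ pB b) (hpB1 : ∑ b, pB b = 1)
    (hpC0 : ∀ c, 0 ≤ pC c) (hpC1 : ∑ c, pC c = 1)
    (hqX0 : ∀ x b c, 0 ≤ qX x b c) (hqX1 : ∀ b c, ∑ x, qX x b c = 1)
    (hqY0 : ∀ y a c, 0 ≤ qY y a c) (hqY1 : ∀ a c, ∑ y, qY y a c = 1)
    (hqZ0 : ∀ z a b, 0 ≤ qZ z a b) (hqZ1 : ∀ a b, ∑ z, qZ z a b = 1)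
    (hfact : ∀ x y z a b c,
      pr μ (fun ω => (X ω, Y ω, Z ω, A ω, B ω, C ω)) (x, y, z, a, b, c)
        = pA a * pB b * pC c * qX x b c * qY y a c * qZ z a b)
    (s : ℕ) (hs : 1 ≤ s) :
    matusMarg3 (s : ℝ) μ X Y Z ∧ matusMarg3 (s : ℝ) μ X Z Y ∧
    matusMarg3 (s : ℝ) μ Y X Z ∧ matusMarg3 (s : ℝ) μ Y Z X ∧
    matusMarg3 (s : ℝ) μ Z X Y ∧ matusMarg3 (s : ℝ) μ Z Y X := by
  have htri := triangle_entropy_le hμ0 hμ1 X Y Z A B C pA pB pC qX qY qZ hpA0 hpA1 hpB0 hpB1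
    hpC0 hpC1 hqX0 hqX1 hqY0 hqY1 hqZ0 hqZ1 hfact
  simp only [matusMarg3_iff]
  generalize Setoid.ker X = x, Setoid.ker Y = y, Setoid.ker Z = z, Setoid.ker A = a,
    Setoid.ker B = b, Setoid.ker C = c at htri ⊢
  have key := fun p q r a b c h => triangle_marginal_inequality hμ0 hμ1 p q r a b c h s hs
  refine ⟨key x y z b a c ?_, key x z y c a b ?_, key y x z a b c ?_, key y z x c b a ?_,
    key z x y a c b ?_, key z y x b c a ?_⟩ <;>
  · simp only [inf_comm, inf_left_comm] at htri ⊢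
    linarith
end

section
/- Let X, Y, Z, A, B, C be random variables whose joint distribution factorizes as P_{XYZABC} = P_A · P_B · P_C · P_{X|BC} · P_{Y|AC} · P_{Z|AB}. Then −2H(C) − 2H(X) − 2H(Y) − 3H(Z) + H(CX) + H(CY) + H(XY) + 2H(XZ) + 2H(YZ) − H(XYZ) ≥ 0. -/
open Finset
open scoped Classical

/-- Entropy as an expectation over the sample space. -/
theorem ent_eq_sum {Ω β : Type*} [Fintype Ω] [Fintype β] (μ : Ω → ℝ) (U : Ω → β) :
    ent μ U = ∑ ω, -(μ ω * Real.log (∑ ω', if U ω' = U ω then μ ω' else 0)) := by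
  have h : ∀ b, Real.negMulLog (pr μ U b)
      = ∑ ω, if U ω = b then -(μ ω * Real.log (pr μ U b)) else 0 := by
    intro b
    rw [Real.negMulLog]
    nth_rewrite 1 [pr]
    rw [neg_mul, Finset.sum_mul, ← Finset.sum_neg_distrib]
    exact Finset.sum_congr rfl fun ω _ => by split_ifs <;> simp
  unfold ent
  rw [Finset.sum_congr rfl fun b _ => h b, Finset.sum_comm]
  exact Finset.sum_congr rfl fun ω _ => by
    rw [Finset.sum_ite_eq]
    simp [pr]

/-- Entropy depends only on the partition of the sample space induced by a random variable. -/
theorem ent_congr {Ω β γ : Type*} [Fintype Ω] [Fintype β] [Fintype γ] (μ : Ω → ℝ)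
    (U : Ω → β) (V : Ω → γ) (h : ∀ ω ω', U ω = U ω' ↔ V ω = V ω') : ent μ U = ent μ V := by
  simp only [ent_eq_sum, h]

theorem ent_const {Ω β : Type*} [Fintype Ω] [Fintype β] (μ : Ω → ℝ) (hμ1 : ∑ ω, μ ω = 1)
    (b : β) : ent μ (fun _ => b) = 0 := by
  simp [ent_eq_sum, hμ1]

theorem pr_nonneg {Ω β : Type*} [Fintype Ω] {μ : Ω → ℝ} (hμ0 : ∀ ω, 0 ≤ μ ω) (U : Ω → β)
    (b : β) : 0 ≤ pr μ U b :=
  Finset.sum_nonneg fun ω _ => by split_ifs <;> simp [hμ0]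

/-- Marginalization: if the pair of `U` and `V` determines and is determined by `W` through
the injection `e`, then the law of `U` is obtained by summing the law of `W`. -/
theorem pr_eq_sum {Ω β γ δ : Type*} [Fintype Ω] [Fintype γ] (μ : Ω → ℝ)
    (U : Ω → β) (V : Ω → γ) (W : Ω → δ) (e : β → γ → δ)
    (he : ∀ ω b c, W ω = e b c ↔ U ω = b ∧ V ω = c) (b : β) :
    pr μ U b = ∑ c, pr μ W (e b c) := by
  unfold pr
  rw [Finset.sum_comm]
  refine Finset.sum_congr rfl fun ω _ => ?_
  by_cases h : U ω = b <;> simp [he, h]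

/-- Subadditivity of entropy for an unnormalized nonnegative matrix. -/
theorem sum_negMulLog_add_le {α β : Type*} [Fintype α] [Fintype β] (p : α → β → ℝ)
    (hp : ∀ a b, 0 ≤ p a b) :
    ∑ a, ∑ b, Real.negMulLog (p a b) + Real.negMulLog (∑ a, ∑ b, p a b)
      ≤ ∑ a, Real.negMulLog (∑ b, p a b) + ∑ b, Real.negMulLog (∑ a, p a b) := by
  set r : α → ℝ := fun a => ∑ b, p a b with hr
  set c : β → ℝ := fun b => ∑ a, p a b with hc
  set S : ℝ := ∑ a, ∑ b, p a b with hS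
  have hr0 : ∀ a, 0 ≤ r a := fun a => Finset.sum_nonneg fun b _ => hp a b
  have hc0 : ∀ b, 0 ≤ c b := fun b => Finset.sum_nonneg fun a _ => hp a b
  have hS0 : 0 ≤ S := Finset.sum_nonneg fun a _ => hr0 a
  have hpr : ∀ a b, p a b ≤ r a := fun a b =>
    Finset.single_le_sum (f := fun b => p a b) (fun b _ => hp a b) (Finset.mem_univ b)
  have hpc : ∀ a b, p a b ≤ c b := fun a b =>
    Finset.single_le_sum (f := fun a => p a b) (fun a _ => hp a b) (Finset.mem_univ a)
  have hrS : ∀ a, r a ≤ S := fun a =>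
    Finset.single_le_sum (f := r) (fun a _ => hr0 a) (Finset.mem_univ a)
  have hcS : ∑ b, c b = S := Finset.sum_comm
  have key : ∀ a b, p a b - r a * c b / S
      ≤ p a b * (Real.log (p a b) + Real.log S - Real.log (r a) - Real.log (c b)) := by
    intro a b
    rcases (hp a b).eq_or_lt with h | h
    · rw [← h]
      have := div_nonneg (mul_nonneg (hr0 a) (hc0 b)) hS0
      linarith
    · have h1 := h.trans_le (hpr a b)
      have h2 := h.trans_le (hpc a b)
      have h3 := h1.trans_le (hrS a)
      have hl := Real.log_le_sub_one_of_pos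
        (show 0 < r a * c b / (p a b * S) by positivity)
      rw [Real.log_div (by positivity) (by positivity), Real.log_mul h1.ne' h2.ne',
        Real.log_mul h.ne' h3.ne'] at hl
      have hm := mul_le_mul_of_nonneg_left hl h.le
      have he : p a b * (r a * c b / (p a b * S) - 1) = r a * c b / S - p a b := by
        field_simp
      rw [he] at hm
      linarith
  have hsum := Finset.sum_le_sum fun a (_ : a ∈ Finset.univ) =>
    Finset.sum_le_sum fun b (_ : b ∈ Finset.univ) => key a b
  have hleft : ∑ a, ∑ b, (p a b - r a * c b / S) = 0 := by
    have : ∑ a, ∑ b, r a * c b / S = S * S / S := by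
      simp only [← Finset.sum_div, ← Finset.mul_sum, hcS, ← Finset.sum_mul]
      rfl
    simp only [Finset.sum_sub_distrib]
    rw [this, mul_self_div_self, sub_eq_zero]
  have hright : ∑ a, ∑ b,
      p a b * (Real.log (p a b) + Real.log S - Real.log (r a) - Real.log (c b))
      = -(∑ a, ∑ b, Real.negMulLog (p a b)) - Real.negMulLog S
        + ∑ a, Real.negMulLog (r a) + ∑ b, Real.negMulLog (c b) := by
    have e1 : ∑ a, ∑ b, p a b * Real.log S = S * Real.log S := by
      simp only [← Finset.sum_mul, hS]
    have e2 : ∑ a, ∑ b, p a b * Real.log (r a) = ∑ a, r a * Real.log (r a) := by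
      simp only [← Finset.sum_mul, hr]
    have e3 : ∑ a, ∑ b, p a b * Real.log (c b) = ∑ b, c b * Real.log (c b) := by
      rw [Finset.sum_comm]
      simp only [← Finset.sum_mul, hc]
    simp only [mul_sub, mul_add, Finset.sum_sub_distrib, Finset.sum_add_distrib, e1, e2, e3,
      Real.negMulLog_eq_neg, Finset.sum_neg_distrib]
    ring
  rw [hleft, hright] at hsum
  linarith

/-- Conditional mutual information as a sum over the values of the conditioning variable,
in terms of the joint distribution only. -/
theorem cmi_eq_sum {Ω β γ δ : Type*} [Fintype Ω] [Fintype β] [Fintype γ] [Fintype δ]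
    (μ : Ω → ℝ) (U : Ω → β) (V : Ω → γ) (W : Ω → δ) (p : β → γ → δ → ℝ)
    (hp : ∀ u v w, pr μ (fun ω => (U ω, V ω, W ω)) (u, v, w) = p u v w) :
    cmi μ U V W = ∑ w, (∑ u, Real.negMulLog (∑ v, p u v w)
      + ∑ v, Real.negMulLog (∑ u, p u v w) - Real.negMulLog (∑ u, ∑ v, p u v w)
      - ∑ u, ∑ v, Real.negMulLog (p u v w)) := by
  have hUW : ∀ u w, pr μ (fun ω => (U ω, W ω)) (u, w) = ∑ v, p u v w := fun u w => by
    rw [pr_eq_sum μ _ V (fun ω => (U ω, V ω, W ω)) (fun b v => (b.1, v, b.2))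
      (by intro ω b v; simp only [Prod.ext_iff]; tauto)]
    simp only [hp]
  have hVW : ∀ v w, pr μ (fun ω => (V ω, W ω)) (v, w) = ∑ u, p u v w := fun v w => by
    rw [pr_eq_sum μ _ U (fun ω => (U ω, V ω, W ω)) (fun b u => (u, b.1, b.2))
      (by intro ω b u; simp only [Prod.ext_iff]; tauto)]
    simp only [hp]
  have hW : ∀ w, pr μ W w = ∑ u, ∑ v, p u v w := fun w => by
    rw [pr_eq_sum μ _ (fun ω => (U ω, V ω)) (fun ω => (U ω, V ω, W ω))
      (fun b u => (u.1, u.2, b)) (by intro ω b u; simp only [Prod.ext_iff]; tauto)]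
    simp only [hp, Fintype.sum_prod_type]
  simp only [cmi, ent, Fintype.sum_prod_type, hUW, hVW, hW, hp, Finset.sum_sub_distrib,
    Finset.sum_add_distrib]
  congr 1
  · congr 1
    congr 1 <;> exact Finset.sum_comm
  · symm
    rw [Finset.sum_comm]
    exact Finset.sum_congr rfl fun u _ => Finset.sum_comm

theorem cmi_nonneg {Ω β γ δ : Type*} [Fintype Ω] [Fintype β] [Fintype γ] [Fintype δ]
    {μ : Ω → ℝ} (hμ0 : ∀ ω, 0 ≤ μ ω) (U : Ω → β) (V : Ω → γ) (W : Ω → δ) :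
    0 ≤ cmi μ U V W := by
  rw [cmi_eq_sum μ U V W _ fun _ _ _ => rfl]
  refine Finset.sum_nonneg fun w _ => ?_
  have := sum_negMulLog_add_le
    (fun u v => pr μ (fun ω => (U ω, V ω, W ω)) (u, v, w)) fun _ _ => pr_nonneg hμ0 _ _
  linarith

/-- Conditional mutual information vanishes when the joint distribution factorizes. -/
theorem cmi_eq_zero_of_factor {Ω β γ δ : Type*} [Fintype Ω] [Fintype β] [Fintype γ]
    [Fintype δ] (μ : Ω → ℝ) (U : Ω → β) (V : Ω → γ) (W : Ω → δ)
    (f : β → δ → ℝ) (g : γ → δ → ℝ)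
    (h : ∀ u v w, pr μ (fun ω => (U ω, V ω, W ω)) (u, v, w) = f u w * g v w) :
    cmi μ U V W = 0 := by
  rw [cmi_eq_sum μ U V W _ h]
  refine Finset.sum_eq_zero fun w _ => ?_
  simp only [← Finset.mul_sum, ← Finset.sum_mul, Real.negMulLog_mul, Finset.sum_add_distrib]
  ring

/-- Entropy is additive on pairs whose joint distribution factorizes. -/
theorem ent_pair_of_factor {Ω β γ : Type*} [Fintype Ω] [Fintype β] [Fintype γ]
    (μ : Ω → ℝ) (hμ1 : ∑ ω, μ ω = 1) (U : Ω → β) (V : Ω → γ) (f : β → ℝ) (g : γ → ℝ)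
    (h : ∀ u v, pr μ (fun ω => (U ω, V ω)) (u, v) = f u * g v) :
    ent μ (fun ω => (U ω, V ω)) = ent μ U + ent μ V := by
  have h0 := cmi_eq_zero_of_factor μ U V (fun _ => ()) (fun u _ => f u) (fun v _ => g v)
    (fun u v _ => by rw [← h]; simp [pr])
  unfold cmi at h0
  rw [ent_const μ hμ1, ent_congr μ (fun ω => (U ω, ())) U (by simp),
    ent_congr μ (fun ω => (V ω, ())) V (by simp),
    ent_congr μ (fun ω => (U ω, V ω, ())) (fun ω => (U ω, V ω)) (by simp)] at h0
  linarith

/-- Entropy is monotone under adjoining a random variable. -/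
theorem ent_le_ent_pair {Ω β γ : Type*} [Fintype Ω] [Fintype β] [Fintype γ]
    {μ : Ω → ℝ} (hμ0 : ∀ ω, 0 ≤ μ ω) (U : Ω → β) (V : Ω → γ) :
    ent μ V ≤ ent μ (fun ω => (U ω, V ω)) := by
  have h := cmi_nonneg hμ0 U U V
  unfold cmi at h
  rw [ent_congr μ (fun ω => (U ω, U ω, V ω)) (fun ω => (U ω, V ω)) (by simp)] at h
  linarith

/-- **Auxiliary marginal inequality (B2).** For every distribution compatible with the
classical triangle causal structure,
`−2H(C) − 2H(X) − 2H(Y) − 3H(Z) + H(CX) + H(CY) + H(XY) + 2H(XZ) + 2H(YZ) − H(XYZ) ≥ 0`. -/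
theorem triangle_aux_ineq_m1
    {Ω SX SY SZ SA SB SC : Type*} [Fintype Ω] [Fintype SX] [Fintype SY] [Fintype SZ]
    [Fintype SA] [Fintype SB] [Fintype SC]
    (μ : Ω → ℝ) (hμ0 : ∀ ω, 0 ≤ μ ω) (hμ1 : ∑ ω, μ ω = 1)
    (X : Ω → SX) (Y : Ω → SY) (Z : Ω → SZ) (A : Ω → SA) (B : Ω → SB) (C : Ω → SC)
    (pA : SA → ℝ) (pB : SB → ℝ) (pC : SC → ℝ)
    (qX : SX → SB → SC → ℝ) (qY : SY → SA → SC → ℝ) (qZ : SZ → SA → SB → ℝ)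
    (hpA0 : ∀ a, 0 ≤ pA a) (hpA1 : ∑ a, pA a = 1)
    (hpB0 : ∀ b, 0 ≤ pB b) (hpB1 : ∑ b, pB b = 1)
    (hpC0 : ∀ c, 0 ≤ pC c) (hpC1 : ∑ c, pC c = 1)
    (hqX0 : ∀ x b c, 0 ≤ qX x b c) (hqX1 : ∀ b c, ∑ x, qX x b c = 1)
    (hqY0 : ∀ y a c, 0 ≤ qY y a c) (hqY1 : ∀ a c, ∑ y, qY y a c = 1)
    (hqZ0 : ∀ z a b, 0 ≤ qZ z a b) (hqZ1 : ∀ a b, ∑ z, qZ z a b = 1)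
    (hfact : ∀ x y z a b c,
      pr μ (fun ω => (X ω, Y ω, Z ω, A ω, B ω, C ω)) (x, y, z, a, b, c)
        = pA a * pB b * pC c * qX x b c * qY y a c * qZ z a b)
    :
    0 ≤ -2 * ent μ C - 2 * ent μ X - 2 * ent μ Y - 3 * ent μ Z
      + ent μ (fun ω => (C ω, X ω)) + ent μ (fun ω => (C ω, Y ω))
      + ent μ (fun ω => (X ω, Y ω))
      + 2 * ent μ (fun ω => (X ω, Z ω)) + 2 * ent μ (fun ω => (Y ω, Z ω))
      - ent μ (fun ω => (X ω, Y ω, Z ω)) := by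
  have hXA : ent μ (fun ω => (X ω, A ω)) = ent μ X + ent μ A := by
    refine ent_pair_of_factor μ hμ1 X A (fun x => ∑ b, pB b * ∑ c, pC c * qX x b c) pA
      fun x a => ?_
    rw [pr_eq_sum μ _ (fun ω => (B ω, C ω, Z ω, Y ω))
      (fun ω => (X ω, Y ω, Z ω, A ω, B ω, C ω))
      (fun u v => (u.1, v.2.2.2, v.2.2.1, u.2, v.1, v.2.1))
      (by intro ω u v; simp only [Prod.ext_iff]; tauto)]
    have h : ∀ b c z y, pA a * pB b * pC c * qX x b c * qY y a c * qZ z a b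
        = pA a * (pB b * (pC c * qX x b c * (qZ z a b * qY y a c))) := by intros; ring
    simp only [hfact, Fintype.sum_prod_type, h, ← Finset.mul_sum, hqY1, hqZ1, mul_one]
    ring
  have hYZA : cmi μ Y Z A = 0 := by
    refine cmi_eq_zero_of_factor μ Y Z A (fun y a => pA a * ∑ c, pC c * qY y a c)
      (fun z a => ∑ b, pB b * qZ z a b) fun y z a => ?_
    rw [pr_eq_sum μ _ (fun ω => (B ω, C ω, X ω))
      (fun ω => (X ω, Y ω, Z ω, A ω, B ω, C ω))
      (fun u v => (v.2.2, u.1, u.2.1, u.2.2, v.1, v.2.1))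
      (by intro ω u v; simp only [Prod.ext_iff]; tauto)]
    have h : ∀ b c x, pA a * pB b * pC c * qX x b c * qY y a c * qZ z a b
        = pA a * (pB b * qZ z a b * (pC c * qY y a c * qX x b c)) := by intros; ring
    simp only [hfact, Fintype.sum_prod_type, h, ← Finset.mul_sum, ← Finset.sum_mul, hqX1,
      mul_one]
    ring
  have hZC : ent μ (fun ω => (Z ω, C ω)) = ent μ Z + ent μ C := by
    refine ent_pair_of_factor μ hμ1 Z C (fun z => ∑ a, pA a * ∑ b, pB b * qZ z a b) pC
      fun z c => ?_
    rw [pr_eq_sum μ _ (fun ω => (A ω, B ω, X ω, Y ω))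
      (fun ω => (X ω, Y ω, Z ω, A ω, B ω, C ω))
      (fun u v => (v.2.2.1, v.2.2.2, u.1, v.1, v.2.1, u.2))
      (by intro ω u v; simp only [Prod.ext_iff]; tauto)]
    have h : ∀ a b x y, pA a * pB b * pC c * qX x b c * qY y a c * qZ z a b
        = pC c * (pA a * (pB b * qZ z a b * (qX x b c * qY y a c))) := by intros; ring
    simp only [hfact, Fintype.sum_prod_type, h, ← Finset.mul_sum, hqX1, hqY1, mul_one]
    ring
  have hAZC : ent μ (fun ω => ((A ω, Z ω), C ω)) = ent μ (fun ω => (A ω, Z ω)) + ent μ C := by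
    refine ent_pair_of_factor μ hμ1 (fun ω => (A ω, Z ω)) C
      (fun u => pA u.1 * ∑ b, pB b * qZ u.2 u.1 b) pC fun u c => ?_
    obtain ⟨a, z⟩ := u
    rw [pr_eq_sum μ _ (fun ω => (B ω, X ω, Y ω))
      (fun ω => (X ω, Y ω, Z ω, A ω, B ω, C ω))
      (fun u v => (v.2.1, v.2.2, u.1.2, u.1.1, v.1, u.2))
      (by intro ω u v; simp only [Prod.ext_iff]; tauto)]
    have h : ∀ b x y, pA a * pB b * pC c * qX x b c * qY y a c * qZ z a b
        = pC c * (pA a * (pB b * qZ z a b * (qX x b c * qY y a c))) := by intros; ring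
    simp only [hfact, Fintype.sum_prod_type, h, ← Finset.mul_sum, hqX1, hqY1, mul_one]
    ring
  have i₁ := cmi_nonneg hμ0 Z C Y
  have i₂ := cmi_nonneg hμ0 Y Z (fun ω => (X ω, A ω))
  have i₃ := cmi_nonneg hμ0 X A Z
  have i₄ := cmi_nonneg hμ0 A X Y
  have i₅ := cmi_nonneg hμ0 X Y (fun ω => (Z ω, C ω))
  have i₆ := cmi_nonneg hμ0 Z C X
  have i₇ := cmi_nonneg hμ0 Y A Z
  have i₈ := cmi_nonneg hμ0 A C (fun ω => (X ω, Y ω, Z ω))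
  have i₉ := ent_le_ent_pair hμ0 (fun ω => (X ω, Y ω)) (fun ω => ((A ω, Z ω), C ω))
  unfold cmi at hYZA i₁ i₂ i₃ i₄ i₅ i₆ i₇ i₈
  have := ent_congr μ (fun ω => (Z ω, Y ω))
    (fun ω => (Y ω, Z ω)) (by intro ω ω'; simp only [Prod.ext_iff]; tauto)
  have := ent_congr μ (fun ω => (Z ω, X ω))
    (fun ω => (X ω, Z ω)) (by intro ω ω'; simp only [Prod.ext_iff]; tauto)
  have := ent_congr μ (fun ω => (Z ω, C ω, Y ω))
    (fun ω => (Y ω, Z ω, C ω)) (by intro ω ω'; simp only [Prod.ext_iff]; tauto)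
  have := ent_congr μ (fun ω => (Z ω, C ω, X ω))
    (fun ω => (X ω, Z ω, C ω)) (by intro ω ω'; simp only [Prod.ext_iff]; tauto)
  have := ent_congr μ (fun ω => (Z ω, X ω, A ω))
    (fun ω => (X ω, A ω, Z ω)) (by intro ω ω'; simp only [Prod.ext_iff]; tauto)
  have := ent_congr μ (fun ω => (Y ω, X ω, A ω))
    (fun ω => (A ω, X ω, Y ω)) (by intro ω ω'; simp only [Prod.ext_iff]; tauto)
  have := ent_congr μ (fun ω => (Y ω, Z ω, X ω, A ω))
    (fun ω => (A ω, X ω, Y ω, Z ω)) (by intro ω ω'; simp only [Prod.ext_iff]; tauto)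
  have := ent_congr μ (fun ω => (C ω, X ω, Y ω, Z ω))
    (fun ω => (X ω, Y ω, Z ω, C ω)) (by intro ω ω'; simp only [Prod.ext_iff]; tauto)
  have := ent_congr μ (fun ω => (Z ω, A ω))
    (fun ω => (A ω, Z ω)) (by intro ω ω'; simp only [Prod.ext_iff]; tauto)
  have := ent_congr μ (fun ω => (Y ω, A ω))
    (fun ω => (A ω, Y ω)) (by intro ω ω'; simp only [Prod.ext_iff]; tauto)
  have := ent_congr μ (fun ω => (Y ω, A ω, Z ω))
    (fun ω => (Y ω, Z ω, A ω)) (by intro ω ω'; simp only [Prod.ext_iff]; tauto)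
  have := ent_congr μ (fun ω => ((X ω, Y ω), (A ω, Z ω), C ω))
    (fun ω => (A ω, C ω, X ω, Y ω, Z ω)) (by intro ω ω'; simp only [Prod.ext_iff]; tauto)
  linarith
end

section
/- Let X, Y, Z, A, B, C be random variables whose joint distribution factorizes as P_{XYZABC} = P_A · P_B · P_C · P_{X|BC} · P_{Y|AC} · P_{Z|AB}, and suppose in addition that the Ingleton inequality I_ING(X,Y;Z,C) ≥ 0 holds for these variables. Then the interaction information of the observed variables is nonpositive: I(X:Y) ≤ I(X:Y|Z). -/
open Finset
open scoped Classical

/-- Law of total probability: if `W = w y` is the event `V = v ∧ Y = y`, then summing over `y`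
recovers the probability of `V = v`. -/
theorem pr_eq_sum_pr {Ω β γ δ : Type*} [Fintype Ω] [Fintype γ] (μ : Ω → ℝ)
    {V : Ω → β} {v : β} (Y : Ω → γ) {W : Ω → δ} {w : γ → δ}
    (h : ∀ ω y, W ω = w y ↔ V ω = v ∧ Y ω = y) :
    pr μ V v = ∑ y, pr μ W (w y) := by
  unfold pr
  rw [Finset.sum_comm]
  refine Finset.sum_congr rfl fun ω _ => ?_
  by_cases hv : V ω = v <;> simp [h, hv]

/-- A product-form joint distribution has zero mutual information. -/
theorem mi_eq_zero_of_pr_eq_mul {Ω β γ : Type*} [Fintype Ω] [Fintype β] [Fintype γ]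
    (μ : Ω → ℝ) (X : Ω → β) (Y : Ω → γ) (f : β → ℝ) (g : γ → ℝ)
    (hf : ∑ x, f x = 1) (hg : ∑ y, g y = 1)
    (h : ∀ x y, pr μ (fun ω => (X ω, Y ω)) (x, y) = f x * g y) :
    mi μ X Y = 0 := by
  have hX : ∀ x, pr μ X x = f x := fun x => by
    rw [pr_eq_sum_pr μ Y (W := fun ω => (X ω, Y ω)) (w := fun y => (x, y)) (by simp)]
    simp only [h, ← Finset.mul_sum, hg, mul_one]
  have hY : ∀ y, pr μ Y y = g y := fun y => by
    rw [pr_eq_sum_pr μ X (W := fun ω => (X ω, Y ω)) (w := fun x => (x, y))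
      (by simp [and_comm])]
    simp only [h, ← Finset.sum_mul, hf, one_mul]
  simp only [mi, ent, hX, hY, h, Fintype.sum_prod_type, Real.negMulLog_mul,
    Finset.sum_add_distrib, ← Finset.sum_mul, ← Finset.mul_sum, hf, hg]
  ring

/-- A joint distribution of the form `P_Z · P_{X|Z} · P_{Y|Z}` has zero conditional mutual
information. -/
theorem cmi_eq_zero_of_pr_eq_mul {Ω β γ δ : Type*} [Fintype Ω] [Fintype β] [Fintype γ]
    [Fintype δ] (μ : Ω → ℝ) (X : Ω → β) (Y : Ω → γ) (Z : Ω → δ)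
    (p : δ → ℝ) (f : β → δ → ℝ) (g : γ → δ → ℝ)
    (hf : ∀ z, ∑ x, f x z = 1) (hg : ∀ z, ∑ y, g y z = 1)
    (h : ∀ x y z, pr μ (fun ω => (X ω, Y ω, Z ω)) (x, y, z) = p z * (f x z * g y z)) :
    cmi μ X Y Z = 0 := by
  have hXZ : ∀ x z, pr μ (fun ω => (X ω, Z ω)) (x, z) = p z * f x z := fun x z => by
    rw [pr_eq_sum_pr μ Y (W := fun ω => (X ω, Y ω, Z ω)) (w := fun y => (x, y, z))
      (by simp; tauto)]
    simp only [h, ← Finset.mul_sum, hg, mul_one]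
  have hYZ : ∀ y z, pr μ (fun ω => (Y ω, Z ω)) (y, z) = p z * g y z := fun y z => by
    rw [pr_eq_sum_pr μ X (W := fun ω => (X ω, Y ω, Z ω)) (w := fun x => (x, y, z))
      (by simp; tauto)]
    simp only [h, ← Finset.mul_sum, ← Finset.sum_mul, hf, one_mul]
  have hZ : ∀ z, pr μ Z z = p z := fun z => by
    rw [pr_eq_sum_pr μ X (W := fun ω => (X ω, Z ω)) (w := fun x => (x, z))
      (by simp [and_comm])]
    simp only [hXZ, ← Finset.mul_sum, hf, mul_one]
  have hXZ' : ent μ (fun ω => (X ω, Z ω))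
      = ∑ z, (Real.negMulLog (p z) + p z * ∑ x, Real.negMulLog (f x z)) := by
    simp only [ent, hXZ, Fintype.sum_prod_type_right, Real.negMulLog_mul,
      Finset.sum_add_distrib, ← Finset.sum_mul, ← Finset.mul_sum, hf, one_mul]
  have hYZ' : ent μ (fun ω => (Y ω, Z ω))
      = ∑ z, (Real.negMulLog (p z) + p z * ∑ y, Real.negMulLog (g y z)) := by
    simp only [ent, hYZ, Fintype.sum_prod_type_right, Real.negMulLog_mul,
      Finset.sum_add_distrib, ← Finset.sum_mul, ← Finset.mul_sum, hg, one_mul]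
  have hXYZ' : ent μ (fun ω => (X ω, Y ω, Z ω))
      = ∑ z, (Real.negMulLog (p z)
        + p z * (∑ x, Real.negMulLog (f x z) + ∑ y, Real.negMulLog (g y z))) := by
    have hswap : ent μ (fun ω => (X ω, Y ω, Z ω))
        = ∑ z, ∑ x, ∑ y, Real.negMulLog (p z * (f x z * g y z)) := by
      simp only [ent, Fintype.sum_prod_type, h]
      rw [Finset.sum_comm (s := (Finset.univ : Finset δ))]
      exact Finset.sum_congr rfl fun x _ => Finset.sum_comm
    rw [hswap]
    simp only [Real.negMulLog_mul, Finset.sum_add_distrib, ← Finset.sum_mul,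
      ← Finset.mul_sum, hf, hg, one_mul]
  have hZ' : ent μ Z = ∑ z, Real.negMulLog (p z) := by simp only [ent, hZ]
  rw [cmi, hXZ', hYZ', hXYZ', hZ']
  simp only [mul_add, Finset.sum_add_distrib]
  ring

/-- For every distribution compatible with the classical triangle causal structure that
in addition satisfies the Ingleton inequality `I_ING(X,Y;Z,C) ≥ 0`, the interaction
information of the observed variables is nonpositive: `I(X:Y) ≤ I(X:Y|Z)`. -/
theorem triangle_ingleton_implies_interaction_nonpos
    {Ω SX SY SZ SA SB SC : Type*} [Fintype Ω] [Fintype SX] [Fintype SY] [Fintype SZ]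
    [Fintype SA] [Fintype SB] [Fintype SC]
    (μ : Ω → ℝ) (hμ0 : ∀ ω, 0 ≤ μ ω) (hμ1 : ∑ ω, μ ω = 1)
    (X : Ω → SX) (Y : Ω → SY) (Z : Ω → SZ) (A : Ω → SA) (B : Ω → SB) (C : Ω → SC)
    (pA : SA → ℝ) (pB : SB → ℝ) (pC : SC → ℝ)
    (qX : SX → SB → SC → ℝ) (qY : SY → SA → SC → ℝ) (qZ : SZ → SA → SB → ℝ)
    (hpA0 : ∀ a, 0 ≤ pA a) (hpA1 : ∑ a, pA a = 1)
    (hpB0 : ∀ b, 0 ≤ pB b) (hpB1 : ∑ b, pB b = 1)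
    (hpC0 : ∀ c, 0 ≤ pC c) (hpC1 : ∑ c, pC c = 1)
    (hqX0 : ∀ x b c, 0 ≤ qX x b c) (hqX1 : ∀ b c, ∑ x, qX x b c = 1)
    (hqY0 : ∀ y a c, 0 ≤ qY y a c) (hqY1 : ∀ a c, ∑ y, qY y a c = 1)
    (hqZ0 : ∀ z a b, 0 ≤ qZ z a b) (hqZ1 : ∀ a b, ∑ z, qZ z a b = 1)
    (hfact : ∀ x y z a b c,
      pr μ (fun ω => (X ω, Y ω, Z ω, A ω, B ω, C ω)) (x, y, z, a, b, c)
        = pA a * pB b * pC c * qX x b c * qY y a c * qZ z a b)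
    (hIng : 0 ≤ ing μ X Y Z C) :
    mi μ X Y ≤ cmi μ X Y Z := by
  have hXYC : cmi μ X Y C = 0 := by
    refine cmi_eq_zero_of_pr_eq_mul μ X Y C pC (fun x c => ∑ b, pB b * qX x b c)
      (fun y c => ∑ a, pA a * qY y a c) (fun c => ?_) (fun c => ?_) fun x y c => ?_
    · rw [Finset.sum_comm]
      simp only [← Finset.mul_sum, hqX1, mul_one, hpB1]
    · rw [Finset.sum_comm]
      simp only [← Finset.mul_sum, hqY1, mul_one, hpA1]
    · rw [pr_eq_sum_pr μ (fun ω => (A ω, B ω, Z ω))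
        (W := fun ω => (X ω, Y ω, Z ω, A ω, B ω, C ω))
        (w := fun t => (x, y, t.2.2, t.1, t.2.1, c)) (by rintro ω ⟨a, b, z⟩; simp; tauto)]
      simp only [Fintype.sum_prod_type, hfact, ← Finset.mul_sum, hqZ1, mul_one]
      rw [mul_comm (∑ b, _), Finset.sum_mul_sum, Finset.mul_sum]
      simp only [Finset.mul_sum]
      exact Finset.sum_congr rfl fun a _ => Finset.sum_congr rfl fun b _ => by ring
  have hZC : mi μ Z C = 0 := by
    refine mi_eq_zero_of_pr_eq_mul μ Z C (fun z => ∑ a, ∑ b, pA a * pB b * qZ z a b) pC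
      ?_ hpC1 fun z c => ?_
    · rw [Finset.sum_comm]
      simp only [Finset.sum_comm (s := (Finset.univ : Finset SZ)), ← Finset.mul_sum, hqZ1,
        mul_one, hpB1, hpA1]
    · rw [pr_eq_sum_pr μ (fun ω => (A ω, B ω, X ω, Y ω))
        (W := fun ω => (X ω, Y ω, Z ω, A ω, B ω, C ω))
        (w := fun t => (t.2.2.1, t.2.2.2, z, t.1, t.2.1, c))
        (by rintro ω ⟨a, b, x, y⟩; simp; tauto)]
      simp only [Fintype.sum_prod_type, hfact, ← Finset.mul_sum, ← Finset.sum_mul, hqX1,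
        hqY1, mul_one]
      simp only [Finset.sum_mul]
      exact Finset.sum_congr rfl fun a _ => Finset.sum_congr rfl fun b _ => by ring
  rw [ing, hXYC, hZC] at hIng
  linarith
end

section
/- Let A, B, C be independent uniformly distributed random bits, and define X = AND(B,C), Y = AND(A,C) and Z = OR(A,B). Then the interaction information of X, Y, Z is strictly positive: I(X:Y) − I(X:Y|Z) > 0. (Consequently, the entropy vector of this triangle-compatible distribution violates the Ingleton-derived inequality I(X:Y) ≤ I(X:Y|Z), showing that the inner approximation defined by this inequality is a strict subset of the triangle entropy cone.) -/
open Finset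
open scoped Classical

/-- The law of `f ∘ W` is the pushforward along `f` of the law of `W`. -/
lemma pr_comp {Ω α β : Type*} [Fintype Ω] [Fintype α] (μ : Ω → ℝ) (W : Ω → α) (f : α → β)
    (b : β) : pr μ (fun ω => f (W ω)) b = ∑ a, if f a = b then pr μ W a else 0 := by
  simp only [pr, ← Finset.sum_filter]
  rw [Finset.sum_comm' (t' := univ.filter fun ω => f (W ω) = b) (s' := fun ω => {W ω})]
  · simp
  · intro a ω
    simp only [mem_filter, mem_univ, true_and, mem_singleton]
    grind

/-- The entropy of a function of three independent uniform bits. -/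
lemma ent_comp_uniform_bits {Ω β : Type*} [Fintype Ω] [Fintype β] {μ : Ω → ℝ} {A B C : Ω → Bool}
    (hunif : ∀ a b c : Bool, pr μ (fun ω => (A ω, B ω, C ω)) (a, b, c) = 1 / 8)
    (f : Bool × Bool × Bool → β) :
    ent μ (fun ω => f (A ω, B ω, C ω)) =
      ∑ b, Real.negMulLog (∑ a, if f a = b then 1 / 8 else 0) := by
  simp only [ent, pr_comp μ (fun ω => (A ω, B ω, C ω)) f, Fintype.sum_prod_type, hunif]

/-- Comparison of `3 ^ 21` with `2 ^ 22 * 5 ^ 5` on the logarithmic scale. -/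
lemma log_three_lt_log_two_add_log_five :
    21 * Real.log 3 < 22 * Real.log 2 + 5 * Real.log 5 := by
  have h : Real.log (3 ^ 21) < Real.log (2 ^ 22 * 5 ^ 5) :=
    Real.log_lt_log (by norm_num) (by norm_num)
  rw [Real.log_mul (by norm_num) (by norm_num)] at h
  simpa only [Real.log_pow, Nat.cast_ofNat] using h

/-- **Strict positivity of the interaction information for an AND/OR strategy.**
Let `A`, `B`, `C` be independent uniformly distributed random bits and let
`X = AND(B,C)`, `Y = AND(A,C)`, `Z = OR(A,B)`.  Then
`I(X:Y) − I(X:Y|Z) > 0`. -/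
theorem and_or_interaction_info_pos {Ω : Type*} [Fintype Ω]
    (μ : Ω → ℝ) (hμ0 : ∀ ω, 0 ≤ μ ω) (hμ1 : ∑ ω, μ ω = 1)
    (A B C X Y Z : Ω → Bool)
    (hunif : ∀ a b c : Bool, pr μ (fun ω => (A ω, B ω, C ω)) (a, b, c) = 1 / 8)
    (hX : ∀ ω, X ω = (B ω && C ω))
    (hY : ∀ ω, Y ω = (A ω && C ω))
    (hZ : ∀ ω, Z ω = (A ω || B ω)) :
    0 < mi μ X Y - cmi μ X Y Z := by
  obtain rfl : X = fun ω => B ω && C ω := funext hX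
  obtain rfl : Y = fun ω => A ω && C ω := funext hY
  obtain rfl : Z = fun ω => A ω || B ω := funext hZ
  have hent_X := ent_comp_uniform_bits hunif fun w => w.2.1 && w.2.2
  have hent_Y := ent_comp_uniform_bits hunif fun w => w.1 && w.2.2
  have hent_Z := ent_comp_uniform_bits hunif fun w => w.1 || w.2.1
  have hent_XY := ent_comp_uniform_bits hunif fun w => (w.2.1 && w.2.2, w.1 && w.2.2)
  have hent_XZ := ent_comp_uniform_bits hunif fun w => (w.2.1 && w.2.2, w.1 || w.2.1)
  have hent_YZ := ent_comp_uniform_bits hunif fun w => (w.1 && w.2.2, w.1 || w.2.1)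
  have hent_XYZ := ent_comp_uniform_bits hunif fun w =>
    (w.2.1 && w.2.2, w.1 && w.2.2, w.1 || w.2.1)
  have log_four : Real.log 4 = 2 * Real.log 2 := by
    rw [show (4 : ℝ) = 2 ^ 2 by norm_num, Real.log_pow, Nat.cast_ofNat]
  have log_eight : Real.log 8 = 3 * Real.log 2 := by
    rw [show (8 : ℝ) = 2 ^ 3 by norm_num, Real.log_pow, Nat.cast_ofNat]
  rw [mi, cmi, hent_X, hent_Y, hent_Z, hent_XY, hent_XZ, hent_YZ, hent_XYZ]
  simp only [Fintype.sum_prod_type, Fintype.sum_bool, Bool.and_true, Bool.and_false,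
    Bool.or_true, Bool.or_false, Prod.mk.injEq, reduceCtorEq, and_true, and_false, if_true,
    if_false]
  norm_num [Real.negMulLog, Real.log_div, log_four, log_eight]
  linarith [log_three_lt_log_two_add_log_five]
end

section
/- Let v = (v_X, v_Y, v_Z, v_XY, v_XZ, v_YZ, v_XYZ) ∈ ℝ⁷ satisfy: v_XY ≤ v_XYZ, v_XZ ≤ v_XYZ, v_YZ ≤ v_XYZ; v_X + v_Y ≥ v_XY, v_X + v_Z ≥ v_XZ, v_Y + v_Z ≥ v_YZ; and v_XY + v_XZ + v_YZ ≥ v_X + v_Y + v_Z + v_XYZ. Then v is a nonnegative linear combination of the seven vectors (1,1,1,2,2,2,2), (0,0,1,0,1,1,1), (0,1,0,1,0,1,1), (1,0,0,1,1,0,1), (0,1,1,1,1,1,1), (1,0,1,1,1,1,1) and (1,1,0,1,1,1,1). -/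
/-- The seven extremal rays of the inner approximation
`Γ_M^I(C3)` to the marginal entropy cone of the triangle causal structure, with
coordinates ordered as `(v_X, v_Y, v_Z, v_XY, v_XZ, v_YZ, v_XYZ)`. -/
def triangleInnerRays : Fin 7 → Fin 7 → ℝ :=
  ![![1, 1, 1, 2, 2, 2, 2],
    ![0, 0, 1, 0, 1, 1, 1],
    ![0, 1, 0, 1, 0, 1, 1],
    ![1, 0, 0, 1, 1, 0, 1],
    ![0, 1, 1, 1, 1, 1, 1],
    ![1, 0, 1, 1, 1, 1, 1],
    ![1, 1, 0, 1, 1, 1, 1]]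

/-- **Extremal-ray description of the inner approximation.** If
`v = (v_X, v_Y, v_Z, v_XY, v_XZ, v_YZ, v_XYZ) ∈ ℝ⁷` (coordinates `v 0, …, v 6`)
satisfies the three-variable Shannon monotonicity inequalities, the nonnegativity of the
three pairwise mutual informations, and the nonpositivity of the interaction information
(`v_XY + v_XZ + v_YZ ≥ v_X + v_Y + v_Z + v_XYZ`), then `v` is a nonnegative linear
combination of the seven vectors `(1,1,1,2,2,2,2)`, `(0,0,1,0,1,1,1)`, `(0,1,0,1,0,1,1)`,
`(1,0,0,1,1,0,1)`, `(0,1,1,1,1,1,1)`, `(1,0,1,1,1,1,1)` and `(1,1,0,1,1,1,1)`. -/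
theorem triangle_inner_cone_rays (v : Fin 7 → ℝ)
    (hmono1 : v 3 ≤ v 6) (hmono2 : v 4 ≤ v 6) (hmono3 : v 5 ≤ v 6)
    (hmi1 : v 3 ≤ v 0 + v 1) (hmi2 : v 4 ≤ v 0 + v 2) (hmi3 : v 5 ≤ v 1 + v 2)
    (hint : v 0 + v 1 + v 2 + v 6 ≤ v 3 + v 4 + v 5) :
    ∃ c : Fin 7 → ℝ, (∀ i, 0 ≤ c i) ∧
      ∀ j, v j = ∑ i, c i * triangleInnerRays i j := by
  refine ⟨![v 3 + v 4 + v 5 - v 0 - v 1 - v 2 - v 6, v 6 - v 3, v 6 - v 4, v 6 - v 5,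
    v 1 + v 2 - v 5, v 0 + v 2 - v 4, v 0 + v 1 - v 3], fun i => ?_, fun j => ?_⟩
  · fin_cases i <;> simp <;> linarith
  · fin_cases j <;> simp [Fin.sum_univ_succ, triangleInnerRays] <;> ring
end

section
/- For each of the seven vectors v ∈ {(1,1,1,2,2,2,2), (0,0,1,0,1,1,1), (0,1,0,1,0,1,1), (1,0,0,1,1,0,1), (0,1,1,1,1,1,1), (1,0,1,1,1,1,1), (1,1,0,1,1,1,1)} there exist random variables X, Y, Z compatible with the classical triangle causal structure (i.e., there exist random variables A, B, C with joint distribution P_{XYZABC} = P_A · P_B · P_C · P_{X|BC} · P_{Y|AC} · P_{Z|AB}) such that (H(X), H(Y), H(Z), H(XY), H(XZ), H(YZ), H(XYZ)) = (log 2) · v. -/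
open Finset
open scoped Classical

/-- A (finite, classical) model of the triangle causal structure `C3`: a finite
probability space `(Ω, μ)`, random variables `X, Y, Z` (observed) and `A, B, C`
(hidden), whose joint distribution factorises as
`P_{XYZABC} = P_A · P_B · P_C · P_{X|BC} · P_{Y|AC} · P_{Z|AB}`. -/
structure TriangleModel where
  Ω : Type
  [instΩ : Fintype Ω]
  SX : Type
  [instSX : Fintype SX]
  SY : Type
  [instSY : Fintype SY]
  SZ : Type
  [instSZ : Fintype SZ]
  SA : Type
  [instSA : Fintype SA]
  SB : Type
  [instSB : Fintype SB]
  SC : Type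
  [instSC : Fintype SC]
  μ : Ω → ℝ
  X : Ω → SX
  Y : Ω → SY
  Z : Ω → SZ
  A : Ω → SA
  B : Ω → SB
  C : Ω → SC
  pA : SA → ℝ
  pB : SB → ℝ
  pC : SC → ℝ
  qX : SX → SB → SC → ℝ
  qY : SY → SA → SC → ℝ
  qZ : SZ → SA → SB → ℝ
  hμ0 : ∀ ω, 0 ≤ μ ω
  hμ1 : ∑ ω, μ ω = 1
  hpA0 : ∀ a, 0 ≤ pA a
  hpA1 : ∑ a, pA a = 1
  hpB0 : ∀ b, 0 ≤ pB b
  hpB1 : ∑ b, pB b = 1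
  hpC0 : ∀ c, 0 ≤ pC c
  hpC1 : ∑ c, pC c = 1
  hqX0 : ∀ x b c, 0 ≤ qX x b c
  hqX1 : ∀ b c, ∑ x, qX x b c = 1
  hqY0 : ∀ y a c, 0 ≤ qY y a c
  hqY1 : ∀ a c, ∑ y, qY y a c = 1
  hqZ0 : ∀ z a b, 0 ≤ qZ z a b
  hqZ1 : ∀ a b, ∑ z, qZ z a b = 1
  hfact : ∀ x y z a b c,
    pr μ (fun ω => (X ω, Y ω, Z ω, A ω, B ω, C ω)) (x, y, z, a, b, c)
      = pA a * pB b * pC c * qX x b c * qY y a c * qZ z a b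

attribute [instance] TriangleModel.instΩ TriangleModel.instSX TriangleModel.instSY
  TriangleModel.instSZ TriangleModel.instSA TriangleModel.instSB TriangleModel.instSC

/-- The entropy vector `(H(X), H(Y), H(Z), H(XY), H(XZ), H(YZ), H(XYZ))` of the observed
variables of a triangle model. -/
noncomputable def TriangleModel.entVec (M : TriangleModel) : Fin 7 → ℝ :=
  ![ent M.μ M.X, ent M.μ M.Y, ent M.μ M.Z,
    ent M.μ (fun ω => (M.X ω, M.Y ω)),
    ent M.μ (fun ω => (M.X ω, M.Z ω)),
    ent M.μ (fun ω => (M.Y ω, M.Z ω)),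
    ent M.μ (fun ω => (M.X ω, M.Y ω, M.Z ω))]

/-- A variable that is uniform on a set of `2 ^ j` values, for a uniformly distributed sample,
has entropy `j * log 2`. -/
theorem ent_uniform_eq_mul_log_two {Ω β : Type*} [Fintype Ω] [Fintype β] [DecidableEq β]
    [Nonempty Ω] (X : Ω → β) (k j : ℕ) (hcard : Fintype.card Ω = k * 2 ^ j)
    (hfiber : ∀ b, #{ω | X ω = b} ∈ ({0, k} : Finset ℕ)) :
    ent (fun _ => (Fintype.card Ω : ℝ)⁻¹) X = Real.log 2 * j := by
  have hN : (Fintype.card Ω : ℝ) ≠ 0 := by exact_mod_cast Fintype.card_ne_zero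
  have hNk : (Fintype.card Ω : ℝ) = k * 2 ^ j := by exact_mod_cast hcard
  have hk : (k : ℝ) ≠ 0 := fun h => hN (by rw [hNk, h, zero_mul])
  have hpr (b : β) : pr (fun _ => (Fintype.card Ω : ℝ)⁻¹) X b
      = #{ω | X ω = b} * (Fintype.card Ω : ℝ)⁻¹ := by
    simp [pr, Finset.sum_ite]
  have hterm (b : β) : Real.negMulLog (pr (fun _ => (Fintype.card Ω : ℝ)⁻¹) X b)
      = #{ω | X ω = b} * ((Fintype.card Ω : ℝ)⁻¹ * (Real.log 2 * j)) := by
    rw [hpr]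
    have hb := hfiber b
    rw [Finset.mem_insert, Finset.mem_singleton] at hb
    rcases hb with h | h <;> rw [h]
    · simp
    · have hq : (k : ℝ) * (Fintype.card Ω : ℝ)⁻¹ = (2 ^ j)⁻¹ := by
        rw [hNk]; field_simp
      rw [← mul_assoc, hq, Real.negMulLog, Real.log_inv, Real.log_pow]
      ring
  have hsum : ∑ b, (#{ω | X ω = b} : ℝ) = Fintype.card Ω := by
    rw [← Finset.card_univ, Finset.card_eq_sum_card_fiberwise (f := X) (t := univ) (by simp)]
    push_cast
    rfl
  rw [ent, Finset.sum_congr rfl fun b _ => hterm b, ← Finset.sum_mul, hsum,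
    mul_inv_cancel_left₀ hN]

/-- The triangle model whose hidden variables are independent uniform bits and whose observed
variables are the functions `f`, `g`, `h` of the adjacent hidden bits. -/
noncomputable def TriangleModel.ofBits (f g h : Bool → Bool → Bool) : TriangleModel where
  Ω := Bool × Bool × Bool
  SX := Bool
  SY := Bool
  SZ := Bool
  SA := Bool
  SB := Bool
  SC := Bool
  μ := fun _ => (Fintype.card (Bool × Bool × Bool) : ℝ)⁻¹
  X := fun ω => f ω.2.1 ω.2.2
  Y := fun ω => g ω.1 ω.2.2
  Z := fun ω => h ω.1 ω.2.1
  A := fun ω => ω.1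
  B := fun ω => ω.2.1
  C := fun ω => ω.2.2
  pA := fun _ => 2⁻¹
  pB := fun _ => 2⁻¹
  pC := fun _ => 2⁻¹
  qX := fun x b c => if f b c = x then 1 else 0
  qY := fun y a c => if g a c = y then 1 else 0
  qZ := fun z a b => if h a b = z then 1 else 0
  hμ0 := fun _ => by positivity
  hμ1 := by simp
  hpA0 := fun _ => by positivity
  hpA1 := by simp
  hpB0 := fun _ => by positivity
  hpB1 := by simp
  hpC0 := fun _ => by positivity
  hpC1 := by simp
  hqX0 := fun _ _ _ => by positivity
  hqX1 := fun _ _ => by simp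
  hqY0 := fun _ _ _ => by positivity
  hqY1 := fun _ _ => by simp
  hqZ0 := fun _ _ _ => by positivity
  hqZ1 := fun _ _ => by simp
  hfact := fun x y z a b c => by
    rw [pr, Fintype.sum_eq_single (a, b, c)]
    · by_cases hx : f b c = x <;> by_cases hy : g a c = y <;> by_cases hz : h a b = z <;>
        simp [hx, hy, hz]
      norm_num
    · rintro ω hne
      refine if_neg fun heq => hne ?_
      simp only [Prod.mk.injEq] at heq
      exact Prod.ext heq.2.2.2.1 (Prod.ext heq.2.2.2.2.1 heq.2.2.2.2.2)

/-- If each joint observed variable of `TriangleModel.ofBits f g h` is uniform on a set of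
`2 ^ v i` values, the entropy vector of the model is `log 2` times `v`. -/
theorem TriangleModel.entVec_ofBits (f g h : Bool → Bool → Bool) (v : Fin 7 → ℕ)
    (hv : ∀ i, 8 = 8 / 2 ^ v i * 2 ^ v i)
    (hX : ∀ s, #{ω : Bool × Bool × Bool | f ω.2.1 ω.2.2 = s}
      ∈ ({0, 8 / 2 ^ v 0} : Finset ℕ))
    (hY : ∀ s, #{ω : Bool × Bool × Bool | g ω.1 ω.2.2 = s}
      ∈ ({0, 8 / 2 ^ v 1} : Finset ℕ))
    (hZ : ∀ s, #{ω : Bool × Bool × Bool | h ω.1 ω.2.1 = s}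
      ∈ ({0, 8 / 2 ^ v 2} : Finset ℕ))
    (hXY : ∀ s, #{ω : Bool × Bool × Bool | (f ω.2.1 ω.2.2, g ω.1 ω.2.2) = s}
      ∈ ({0, 8 / 2 ^ v 3} : Finset ℕ))
    (hXZ : ∀ s, #{ω : Bool × Bool × Bool | (f ω.2.1 ω.2.2, h ω.1 ω.2.1) = s}
      ∈ ({0, 8 / 2 ^ v 4} : Finset ℕ))
    (hYZ : ∀ s, #{ω : Bool × Bool × Bool | (g ω.1 ω.2.2, h ω.1 ω.2.1) = s}
      ∈ ({0, 8 / 2 ^ v 5} : Finset ℕ))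
    (hXYZ : ∀ s, #{ω : Bool × Bool × Bool | (f ω.2.1 ω.2.2, g ω.1 ω.2.2, h ω.1 ω.2.1) = s}
      ∈ ({0, 8 / 2 ^ v 6} : Finset ℕ)) :
    (TriangleModel.ofBits f g h).entVec = fun i => Real.log 2 * v i := by
  funext i
  fin_cases i
  · exact ent_uniform_eq_mul_log_two (Ω := Bool × Bool × Bool) _ _ _ (hv 0) hX
  · exact ent_uniform_eq_mul_log_two (Ω := Bool × Bool × Bool) _ _ _ (hv 1) hY
  · exact ent_uniform_eq_mul_log_two (Ω := Bool × Bool × Bool) _ _ _ (hv 2) hZ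
  · exact ent_uniform_eq_mul_log_two (Ω := Bool × Bool × Bool) _ _ _ (hv 3) hXY
  · exact ent_uniform_eq_mul_log_two (Ω := Bool × Bool × Bool) _ _ _ (hv 4) hXZ
  · exact ent_uniform_eq_mul_log_two (Ω := Bool × Bool × Bool) _ _ _ (hv 5) hYZ
  · exact ent_uniform_eq_mul_log_two (Ω := Bool × Bool × Bool) _ _ _ (hv 6) hXYZ

/-- **Achievability of the seven extremal rays.** Each of the seven listed vectors is,
after scaling by `log 2`, the entropy vector of the observed variables of some
distribution compatible with the classical triangle causal structure. -/
theorem triangle_rays_achievable :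
    ∀ v ∈ ([![1, 1, 1, 2, 2, 2, 2],
            ![0, 0, 1, 0, 1, 1, 1],
            ![0, 1, 0, 1, 0, 1, 1],
            ![1, 0, 0, 1, 1, 0, 1],
            ![0, 1, 1, 1, 1, 1, 1],
            ![1, 0, 1, 1, 1, 1, 1],
            ![1, 1, 0, 1, 1, 1, 1]] : List (Fin 7 → ℝ)),
      ∃ M : TriangleModel, M.entVec = fun i => Real.log 2 * v i := by
  intro v hv
  simp only [List.mem_cons, List.not_mem_nil, or_false] at hv
  rcases hv with rfl | rfl | rfl | rfl | rfl | rfl | rfl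
  · refine ⟨_, (TriangleModel.entVec_ofBits xor xor xor
      ![1, 1, 1, 2, 2, 2, 2] ?_ ?_ ?_ ?_ ?_ ?_ ?_ ?_).trans ?_⟩
    on_goal 9 => funext i; fin_cases i <;> simp
    all_goals decide
  · refine ⟨_, (TriangleModel.entVec_ofBits (fun _ _ => false) (fun _ _ => false) (fun a _ => a)
      ![0, 0, 1, 0, 1, 1, 1] ?_ ?_ ?_ ?_ ?_ ?_ ?_ ?_).trans ?_⟩
    on_goal 9 => funext i; fin_cases i <;> simp
    all_goals decide
  · refine ⟨_, (TriangleModel.entVec_ofBits (fun _ _ => false) (fun a _ => a) (fun _ _ => false)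
      ![0, 1, 0, 1, 0, 1, 1] ?_ ?_ ?_ ?_ ?_ ?_ ?_ ?_).trans ?_⟩
    on_goal 9 => funext i; fin_cases i <;> simp
    all_goals decide
  · refine ⟨_, (TriangleModel.entVec_ofBits (fun a _ => a) (fun _ _ => false) (fun _ _ => false)
      ![1, 0, 0, 1, 1, 0, 1] ?_ ?_ ?_ ?_ ?_ ?_ ?_ ?_).trans ?_⟩
    on_goal 9 => funext i; fin_cases i <;> simp
    all_goals decide
  · refine ⟨_, (TriangleModel.entVec_ofBits (fun _ _ => false) (fun a _ => a) (fun a _ => a)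
      ![0, 1, 1, 1, 1, 1, 1] ?_ ?_ ?_ ?_ ?_ ?_ ?_ ?_).trans ?_⟩
    on_goal 9 => funext i; fin_cases i <;> simp
    all_goals decide
  · refine ⟨_, (TriangleModel.entVec_ofBits (fun a _ => a) (fun _ _ => false) (fun _ b => b)
      ![1, 0, 1, 1, 1, 1, 1] ?_ ?_ ?_ ?_ ?_ ?_ ?_ ?_).trans ?_⟩
    on_goal 9 => funext i; fin_cases i <;> simp
    all_goals decide
  · refine ⟨_, (TriangleModel.entVec_ofBits (fun _ b => b) (fun _ b => b) (fun _ _ => false)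
      ![1, 1, 0, 1, 1, 1, 1] ?_ ?_ ?_ ?_ ?_ ?_ ?_ ?_).trans ?_⟩
    on_goal 9 => funext i; fin_cases i <;> simp
    all_goals decide
end

section
/- Let 𝒜, ℬ, 𝒞 be finite types with probability mass functions p_A, p_B, p_C, and let κ_Z : 𝒜 × ℬ → PMF({0,1}), κ_Ã : 𝒜 × 𝒞 → PMF({0,1}), κ_B̃ : ℬ × 𝒞 → PMF({0,1}) be conditional distributions. Define the joint distribution P(z, ã, b̃) = Σ_{a,b,c} p_A(a) p_B(b) p_C(c) κ_Z(a,b)(z) κ_Ã(a,c)(ã) κ_B̃(b,c)(b̃). Suppose P(z, ã, b̃) = 0 whenever z ≠ AND(ã, b̃), and P(1,1,1) > 0. Then the conditional distributions of Ã and B̃ do not depend on C on the support: for every a with p_A(a) > 0 and every c, c' with p_C(c) > 0 and p_C(c') > 0, κ_Ã(a,c) = κ_Ã(a,c'); and for every b with p_B(b) > 0 and every such c, c', κ_B̃(b,c) = κ_B̃(b,c'). -/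
open scoped ENNReal

/-- A probability mass function on `Bool` that vanishes at `b` is nonzero at `!b`. -/
theorem PMF.bool_not_ne_zero {p : PMF Bool} {b : Bool} (h : p b = 0) : p (!b) ≠ 0 := by
  intro h'
  have hs := p.tsum_coe
  rw [tsum_bool] at hs
  cases b <;> simp_all

/-- Two probability mass functions on `Bool` that vanish at a common point are equal. -/
theorem PMF.bool_eq_of_apply_eq_zero {p q : PMF Bool} {b : Bool} (hp : p b = 0) (hq : q b = 0) :
    p = q := by
  have hps := p.tsum_coe
  have hqs := q.tsum_coe
  rw [tsum_bool] at hps hqs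
  ext x
  cases b <;> cases x <;> simp_all

/-- `μ`, `α`, `β` are distributions of bits such that, drawn independently, the first one is almost
surely the conjunction of the other two. -/
def IsAndTriple (μ α β : PMF Bool) : Prop :=
  ∀ z ta tb, z ≠ (ta && tb) → μ z = 0 ∨ α ta = 0 ∨ β tb = 0

theorem IsAndTriple.symm {μ α β : PMF Bool} (h : IsAndTriple μ α β) : IsAndTriple μ β α :=
  fun z ta tb hz => (h z tb ta (by rwa [Bool.and_comm])).imp_right Or.symm

theorem IsAndTriple.left_false_eq_zero {μ α β : PMF Bool} (h : IsAndTriple μ α β)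
    (hμ : μ true ≠ 0) : α false = 0 := by
  obtain ⟨tb, htb⟩ := β.support_nonempty
  have hβ : β tb ≠ 0 := htb
  simpa [hμ, hβ] using h true false tb (by simp)

/-- If the second factor is almost surely `true`, the first factor is determined by `μ`. -/
theorem IsAndTriple.left_unique {μ α α' β β' : PMF Bool} (h : IsAndTriple μ α β)
    (h' : IsAndTriple μ α' β') (hβ : β false = 0) (hβ' : β' false = 0) : α = α' := by
  by_cases hμ : μ true = 0
  · have hf : μ false ≠ 0 := PMF.bool_not_ne_zero hμ
    have ht : β true ≠ 0 := PMF.bool_not_ne_zero hβ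
    have ht' : β' true ≠ 0 := PMF.bool_not_ne_zero hβ'
    refine PMF.bool_eq_of_apply_eq_zero (b := true) ?_ ?_
    · simpa [hf, ht] using h false true true (by simp)
    · simpa [hf, ht'] using h' false true true (by simp)
  · exact PMF.bool_eq_of_apply_eq_zero (h.left_false_eq_zero hμ) (h'.left_false_eq_zero hμ)

/-- **Lemma (identification of the causes in the triangle with `Z = AND(Ã,B̃)`).**
Let `pA, pB, pC` be probability mass functions on finite types `𝒜, ℬ, 𝒞`, and let
`κZ, κA, κB` be conditional distributions generating the observed bits `Z`, `Ã` and `B̃`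
from `(A,B)`, `(A,C)` and `(B,C)` respectively, with induced joint distribution
`P(z, ã, b̃) = Σ_{a,b,c} pA(a) pB(b) pC(c) κZ(a,b)(z) κA(a,c)(ã) κB(b,c)(b̃)`.
If `P(z, ã, b̃) = 0` whenever `z ≠ AND(ã, b̃)`, and `P(1,1,1) > 0`, then on the support
the conditional distributions of `Ã` and `B̃` do not depend on `C`. -/
theorem triangle_and_no_C_dependence {𝒜 ℬ 𝒞 : Type*} [Fintype 𝒜] [Fintype ℬ] [Fintype 𝒞]
    (pA : PMF 𝒜) (pB : PMF ℬ) (pC : PMF 𝒞)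
    (κZ : 𝒜 × ℬ → PMF Bool) (κA : 𝒜 × 𝒞 → PMF Bool) (κB : ℬ × 𝒞 → PMF Bool)
    (P : Bool → Bool → Bool → ℝ≥0∞)
    (hP : ∀ z ta tb, P z ta tb
      = ∑ a : 𝒜, ∑ b : ℬ, ∑ c : 𝒞,
          pA a * pB b * pC c * κZ (a, b) z * κA (a, c) ta * κB (b, c) tb)
    (hand : ∀ z ta tb, z ≠ (ta && tb) → P z ta tb = 0)
    (hpos : 0 < P true true true) :
    (∀ a, 0 < pA a → ∀ c c', 0 < pC c → 0 < pC c' → κA (a, c) = κA (a, c')) ∧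
    (∀ b, 0 < pB b → ∀ c c', 0 < pC c → 0 < pC c' → κB (b, c) = κB (b, c')) := by
  have key : ∀ a b c, 0 < pA a → 0 < pB b → 0 < pC c →
      IsAndTriple (κZ (a, b)) (κA (a, c)) (κB (b, c)) := by
    intro a b c ha hb hc z ta tb hz
    have h0 := hand z ta tb hz
    simp only [hP, Finset.sum_eq_zero_iff, Finset.mem_univ, true_imp_iff] at h0
    simpa [ha.ne', hb.ne', hc.ne', or_assoc] using h0 a b c
  obtain ⟨a₀, b₀, ha₀, hb₀, hz⟩ : ∃ a b, 0 < pA a ∧ 0 < pB b ∧ κZ (a, b) true ≠ 0 := by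
    rw [hP] at hpos
    obtain ⟨a, -, h⟩ := Finset.exists_ne_zero_of_sum_ne_zero hpos.ne'
    obtain ⟨b, -, h⟩ := Finset.exists_ne_zero_of_sum_ne_zero h
    obtain ⟨c, -, h⟩ := Finset.exists_ne_zero_of_sum_ne_zero h
    simp only [mul_ne_zero_iff] at h
    exact ⟨a, b, pos_iff_ne_zero.2 h.1.1.1.1.1, pos_iff_ne_zero.2 h.1.1.1.1.2, h.1.1.2⟩
  have hA : ∀ c, 0 < pC c → κA (a₀, c) false = 0 := fun c hc =>
    (key a₀ b₀ c ha₀ hb₀ hc).left_false_eq_zero hz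
  have hB : ∀ c, 0 < pC c → κB (b₀, c) false = 0 := fun c hc =>
    (key a₀ b₀ c ha₀ hb₀ hc).symm.left_false_eq_zero hz
  exact ⟨fun a ha c c' hc hc' =>
      (key a b₀ c ha hb₀ hc).left_unique (key a b₀ c' ha hb₀ hc') (hB c hc) (hB c' hc'),
    fun b hb c c' hc hc' =>
      (key a₀ b c ha₀ hb hc).symm.left_unique (key a₀ b c' ha₀ hb hc').symm (hA c hc) (hA c' hc')⟩
end

section
/- Let 𝒜, ℬ, 𝒞, 𝒳̃, 𝒴̃ be finite types with probability mass functions p_A, p_B, p_C on the first three, and let κ_X : ℬ × 𝒞 → PMF(𝒳̃ × {0,1}), κ_Y : 𝒜 × 𝒞 → PMF(𝒴̃ × {0,1}), κ_Z : 𝒜 × ℬ → PMF({0,1}) be conditional distributions; write (X̃, B̃) for the output of κ_X, (Ỹ, Ã) for the output of κ_Y, and Z for the output of κ_Z, and let P denote the induced joint distribution P(x̃, b̃, ỹ, ã, z) = Σ_{a,b,c} p_A(a) p_B(b) p_C(c) κ_X(b,c)(x̃,b̃) κ_Y(a,c)(ỹ,ã) κ_Z(a,b)(z). Suppose P is supported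 on z = AND(ã, b̃), that P(Z=1) > 0, and that P(Ã=ã, B̃=b̃) > 0 for all ã, b̃ ∈ {0,1}. Then Ã and B̃ are independent, and the conditional distribution of (X̃, Ỹ) given (Ã, B̃) admits a local hidden-variable decomposition with hidden variable C: for all x̃, ỹ, ã, b̃, P(X̃=x̃, Ỹ=ỹ | Ã=ã, B̃=b̃) = Σ_{c : p_C(c)>0} p_C(c) · P(X̃=x̃ | B̃=b̃, C=c) · P(Ỹ=ỹ | Ã=ã, C=c). -/
open scoped ENNReal Classical

theorem PMF.sum_coe_eq_one {α : Type*} [Fintype α] (p : PMF α) : ∑ a, p a = 1 := by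
  rw [← tsum_fintype (L := .unconditional _)]
  exact p.tsum_coe

/-- The second marginal of a probability mass function on a product. -/
noncomputable def sndMarginal {α : Type*} [Fintype α] (p : PMF (α × Bool)) (t : Bool) : ℝ≥0∞ :=
  ∑ x, p (x, t)

theorem sum_sndMarginal {α : Type*} [Fintype α] (p : PMF (α × Bool)) :
    ∑ t, sndMarginal p t = 1 := by
  unfold sndMarginal
  rw [Finset.sum_comm, ← Fintype.sum_prod_type', PMF.sum_coe_eq_one]

/-- Two normalized weights on bits that both almost surely agree with an independent bit
drawn from `q` coincide: all three are the same point mass. -/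
theorem eq_of_agree_with_bit {V V' : Bool → ℝ≥0∞} (q : PMF Bool)
    (hV : ∑ t, V t = 1) (hV' : ∑ t, V' t = 1)
    (h : ∀ z t, z ≠ t → V t = 0 ∨ q z = 0) (h' : ∀ z t, z ≠ t → V' t = 0 ∨ q z = 0) :
    V = V' := by
  have hq := q.sum_coe_eq_one
  rw [Fintype.sum_bool] at hV hV' hq
  have key : ∀ z, q z ≠ 0 → V (!z) = 0 ∧ V' (!z) = 0 := fun z hz =>
    ⟨(h z (!z) (by simp)).resolve_right hz, (h' z (!z) (by simp)).resolve_right hz⟩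
  by_cases ht : q true = 0
  · have hf : q false ≠ 0 := by
      rintro hf
      simp [ht, hf] at hq
    obtain ⟨h1, h2⟩ := key false hf
    rw [Bool.not_false] at h1 h2
    rw [h1, zero_add] at hV
    rw [h2, zero_add] at hV'
    funext t
    cases t <;> simp [*]
  · obtain ⟨h1, h2⟩ := key true ht
    rw [Bool.not_true] at h1 h2
    rw [h1, add_zero] at hV
    rw [h2, add_zero] at hV'
    funext t
    cases t <;> simp [*]

/-- If two weights on bits, the second normalized, taken independently almost surely yield
the pair `(1, 1)`, then the first puts no mass on `0`. -/
theorem false_eq_zero_of_and {U V : Bool → ℝ≥0∞} (hV : ∑ t, V t = 1)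
    (h : ∀ s t, (s && t) = false → U s = 0 ∨ V t = 0) : U false = 0 := by
  by_contra hU
  have h0 : ∀ t, V t = 0 := fun t => (h false t rfl).resolve_left hU
  simp [h0] at hV

/-- In the triangle with `Z = AND(Ã, B̃)`, the bits `B̃` and `Ã` do not depend on `C`. -/
theorem bits_independent_of_hidden {𝒜 ℬ 𝒞 : Type*} {SA : 𝒜 → Prop} {SB : ℬ → Prop}
    {SC : 𝒞 → Prop} {U : ℬ → 𝒞 → Bool → ℝ≥0∞} {V : 𝒜 → 𝒞 → Bool → ℝ≥0∞}
    {q : 𝒜 × ℬ → PMF Bool}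
    (hU : ∀ b c, ∑ t, U b c t = 1) (hV : ∀ a c, ∑ t, V a c t = 1)
    (h : ∀ a b c, SA a → SB b → SC c → ∀ s t z, z ≠ (t && s) →
      U b c s = 0 ∨ V a c t = 0 ∨ q (a, b) z = 0)
    {a₀ : 𝒜} {b₀ : ℬ} (ha₀ : SA a₀) (hb₀ : SB b₀) (hq : q (a₀, b₀) true ≠ 0) :
    (∀ b c c', SB b → SC c → SC c' → U b c = U b c') ∧
      ∀ a c c', SA a → SC c → SC c' → V a c = V a c' := by
  have hUt : ∀ c, SC c → U b₀ c true ≠ 0 := by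
    intro c hc h0
    have hf : U b₀ c false = 0 := by
      refine false_eq_zero_of_and (hV a₀ c) fun s t hst => ?_
      have := h a₀ b₀ c ha₀ hb₀ hc s t true (by rw [Bool.and_comm, hst]; simp)
      tauto
    simpa [h0, hf] using hU b₀ c
  have hVt : ∀ c, SC c → V a₀ c true ≠ 0 := by
    intro c hc h0
    have hf : V a₀ c false = 0 := by
      refine false_eq_zero_of_and (hU b₀ c) fun t s hst => ?_
      have := h a₀ b₀ c ha₀ hb₀ hc s t true (by rw [hst]; simp)
      tauto
    simpa [h0, hf] using hV a₀ c
  constructor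
  · intro b c c' hb hc hc'
    have agree : ∀ c, SC c → ∀ z t, z ≠ t → U b c t = 0 ∨ q (a₀, b) z = 0 := by
      intro c hc z t hzt
      have := h a₀ b c ha₀ hb hc t true z (by simpa using hzt)
      have := hVt c hc
      tauto
    exact eq_of_agree_with_bit (q (a₀, b)) (hU b c) (hU b c') (agree c hc) (agree c' hc')
  · intro a c c' ha hc hc'
    have agree : ∀ c, SC c → ∀ z t, z ≠ t → V a c t = 0 ∨ q (a, b₀) z = 0 := by
      intro c hc z t hzt
      have := h a b₀ c ha hb₀ hc true t z (by simpa using hzt)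
      have := hUt c hc
      tauto
    exact eq_of_agree_with_bit (q (a, b₀)) (hV a c) (hV a c') (agree c hc) (agree c' hc')

/-- The output distribution of the kernel `κ` at `c`, with its other input averaged out. -/
noncomputable def averageKernel {ℬ 𝒞 𝒳 : Type*} [Fintype ℬ] (p : PMF ℬ)
    (κ : ℬ × 𝒞 → PMF (𝒳 × Bool)) (c : 𝒞) (x : 𝒳) (t : Bool) : ℝ≥0∞ :=
  ∑ b, p b * κ (b, c) (x, t)

theorem sum_averageKernel {ℬ 𝒞 𝒳 : Type*} [Fintype ℬ] [Fintype 𝒳] (p : PMF ℬ)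
    (κ : ℬ × 𝒞 → PMF (𝒳 × Bool)) (c : 𝒞) (t : Bool) :
    ∑ x, averageKernel p κ c x t = ∑ b, p b * sndMarginal (κ (b, c)) t := by
  simp only [averageKernel, sndMarginal, Finset.mul_sum]
  exact Finset.sum_comm

theorem sum_sum_averageKernel {ℬ 𝒞 𝒳 : Type*} [Fintype ℬ] [Fintype 𝒳] (p : PMF ℬ)
    (κ : ℬ × 𝒞 → PMF (𝒳 × Bool)) (c : 𝒞) :
    ∑ t, ∑ x, averageKernel p κ c x t = 1 := by
  simp only [sum_averageKernel]
  rw [Finset.sum_comm]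
  simp only [← Finset.mul_sum, sum_sndMarginal, mul_one, PMF.sum_coe_eq_one]

/-- Local decomposition from conditional independence given `C`, when the marginals `β`, `α`
of the two bits do not depend on `C`. -/
theorem local_decomposition_of_marginals {𝒞 𝒳 𝒴 : Type*} [Fintype 𝒞] [Fintype 𝒳] [Fintype 𝒴]
    (pC : PMF 𝒞) (F : 𝒞 → 𝒳 → Bool → ℝ≥0∞) (G : 𝒞 → 𝒴 → Bool → ℝ≥0∞) (β α : Bool → ℝ≥0∞)
    (hβ : ∑ t, β t = 1) (hα : ∑ t, α t = 1)
    (hF : ∀ c t, pC c ≠ 0 → ∑ x, F c x t = β t) (hG : ∀ c t, pC c ≠ 0 → ∑ y, G c y t = α t)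
    (Pc : 𝒳 → Bool → 𝒴 → Bool → Bool → 𝒞 → ℝ≥0∞)
    (hPc : ∀ tx tb ty ta c, ∑ z, Pc tx tb ty ta z c = pC c * F c tx tb * G c ty ta)
    (P : 𝒳 → Bool → 𝒴 → Bool → Bool → ℝ≥0∞)
    (hP : ∀ tx tb ty ta z, P tx tb ty ta z = ∑ c : 𝒞, Pc tx tb ty ta z c)
    (hABpos : ∀ ta tb : Bool, 0 < ∑ tx : 𝒳, ∑ ty : 𝒴, ∑ z : Bool, P tx tb ty ta z) :
    (∀ ta tb : Bool,
      (∑ tx : 𝒳, ∑ ty : 𝒴, ∑ z : Bool, P tx tb ty ta z)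
        = (∑ tb' : Bool, ∑ tx : 𝒳, ∑ ty : 𝒴, ∑ z : Bool, P tx tb' ty ta z)
          * (∑ ta' : Bool, ∑ tx : 𝒳, ∑ ty : 𝒴, ∑ z : Bool, P tx tb ty ta' z)) ∧
    (∀ (tx : 𝒳) (ty : 𝒴) (ta tb : Bool),
      (∑ z : Bool, P tx tb ty ta z)
          / (∑ tx' : 𝒳, ∑ ty' : 𝒴, ∑ z : Bool, P tx' tb ty' ta z)
        = ∑ c ∈ Finset.univ.filter (fun c : 𝒞 => 0 < pC c),
            pC c
              * ((∑ ty' : 𝒴, ∑ ta' : Bool, ∑ z : Bool, Pc tx tb ty' ta' z c)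
                  / (∑ tx' : 𝒳, ∑ ty' : 𝒴, ∑ ta' : Bool, ∑ z : Bool, Pc tx' tb ty' ta' z c))
              * ((∑ tx' : 𝒳, ∑ tb' : Bool, ∑ z : Bool, Pc tx' tb' ty ta z c)
                  / (∑ tx' : 𝒳, ∑ ty' : 𝒴, ∑ tb' : Bool, ∑ z : Bool, Pc tx' tb' ty' ta z c))) := by
  have hS : ∀ tx tb ty ta, ∑ z, P tx tb ty ta z = ∑ c, pC c * F c tx tb * G c ty ta := by
    intro tx tb ty ta
    simp only [hP, ← hPc]
    exact Finset.sum_comm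
  have hT : ∀ ta tb, ∑ tx, ∑ ty, ∑ z, P tx tb ty ta z = β tb * α ta := by
    intro ta tb
    have hc : ∀ c, ∑ tx, ∑ ty, pC c * F c tx tb * G c ty ta = pC c * (β tb * α ta) := by
      intro c
      by_cases h0 : pC c = 0
      · simp [h0]
      · simp only [← Finset.mul_sum, ← Finset.sum_mul, hF c tb h0, hG c ta h0, mul_assoc]
    calc ∑ tx, ∑ ty, ∑ z, P tx tb ty ta z
        = ∑ tx, ∑ c, ∑ ty, pC c * F c tx tb * G c ty ta := by
          simp only [hS]
          exact Finset.sum_congr rfl fun _ _ => Finset.sum_comm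
      _ = ∑ c, pC c * (β tb * α ta) := by
          rw [Finset.sum_comm]
          exact Finset.sum_congr rfl fun c _ => hc c
      _ = β tb * α ta := by rw [← Finset.sum_mul, pC.sum_coe_eq_one, one_mul]
  refine ⟨fun ta tb => ?_, fun tx ty ta tb => ?_⟩
  · simp only [hT, ← Finset.sum_mul, ← Finset.mul_sum, hβ, hα, one_mul, mul_one]
    exact mul_comm _ _
  · have hne : β tb * α ta ≠ 0 := hT ta tb ▸ (hABpos ta tb).ne'
    have hle : ∀ {w : Bool → ℝ≥0∞}, ∑ t, w t = 1 → ∀ t, w t ≠ ⊤ := by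
      intro w hw t
      exact ((Finset.single_le_sum (fun _ _ => zero_le) (Finset.mem_univ t)).trans_lt
        (hw ▸ ENNReal.one_lt_top)).ne
    rw [hT, hS, div_eq_mul_inv, Finset.sum_mul, Finset.sum_filter]
    refine Finset.sum_congr rfl fun c _ => ?_
    by_cases h0 : pC c = 0
    · simp [h0]
    rw [if_pos (pos_iff_ne_zero.2 h0)]
    have hG1 : ∑ ty', ∑ ta', G c ty' ta' = 1 := by
      rw [Finset.sum_comm, ← hα]
      exact Finset.sum_congr rfl fun t _ => hG c t h0
    have hF1 : ∑ tx', ∑ tb', F c tx' tb' = 1 := by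
      rw [Finset.sum_comm, ← hβ]
      exact Finset.sum_congr rfl fun t _ => hF c t h0
    have e1 : ∀ tx, ∑ ty', ∑ ta', ∑ z, Pc tx tb ty' ta' z c = pC c * F c tx tb := by
      intro tx
      simp only [hPc, ← Finset.mul_sum, hG1, mul_one]
    have e2 : ∀ ty, ∑ tx', ∑ tb', ∑ z, Pc tx' tb' ty ta z c = pC c * G c ty ta := by
      intro ty
      simp only [hPc, ← Finset.mul_sum, ← Finset.sum_mul, hF1, mul_one]
    have e3 : ∑ tx', ∑ ty', ∑ tb', ∑ z, Pc tx' tb' ty' ta z c = pC c * α ta := by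
      rw [Finset.sum_comm]
      simp only [e2, ← Finset.mul_sum, hG c ta h0]
    rw [e3, e2]
    simp only [e1, ← Finset.mul_sum, hF c tb h0]
    have hfin := pC.apply_ne_top c
    rw [ENNReal.mul_div_mul_left _ _ h0 hfin, ENNReal.mul_div_mul_left _ _ h0 hfin,
      ENNReal.mul_inv (.inr (hle hα ta)) (.inl (hle hβ tb)), div_eq_mul_inv, div_eq_mul_inv]
    ring

/-- **Proposition 8 (classical impossibility part): local decomposition forced by
`Z = AND(Ã,B̃)` in the triangle.**  Let `pA, pB, pC` be probability mass functions on
finite types `𝒜, ℬ, 𝒞` and let `κX, κY, κZ` be conditional distributions generating the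
observed pairs `(X̃,B̃)` from `(B,C)`, `(Ỹ,Ã)` from `(A,C)` and the bit `Z` from `(A,B)`.
Write `Pc` for the joint distribution of the observed variables together with the hidden
`C`, and `P` for the observed joint distribution.  If `P` is supported on
`z = AND(ã,b̃)`, `P(Z=1) > 0` and `P(Ã=ã,B̃=b̃) > 0` for all bits `ã, b̃`, then `Ã` and
`B̃` are independent and the conditional distribution of `(X̃,Ỹ)` given `(Ã,B̃)` admits
a local hidden-variable decomposition with hidden variable `C`. -/
theorem triangle_and_local_decomposition
    {𝒜 ℬ 𝒞 𝒳 𝒴 : Type*} [Fintype 𝒜] [Fintype ℬ] [Fintype 𝒞] [Fintype 𝒳] [Fintype 𝒴]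
    (pA : PMF 𝒜) (pB : PMF ℬ) (pC : PMF 𝒞)
    (κX : ℬ × 𝒞 → PMF (𝒳 × Bool)) (κY : 𝒜 × 𝒞 → PMF (𝒴 × Bool))
    (κZ : 𝒜 × ℬ → PMF Bool)
    (Pc : 𝒳 → Bool → 𝒴 → Bool → Bool → 𝒞 → ℝ≥0∞)
    (hPc : ∀ tx tb ty ta z c, Pc tx tb ty ta z c
      = ∑ a : 𝒜, ∑ b : ℬ,
          pA a * pB b * pC c * κX (b, c) (tx, tb) * κY (a, c) (ty, ta) * κZ (a, b) z)
    (P : 𝒳 → Bool → 𝒴 → Bool → Bool → ℝ≥0∞)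
    (hP : ∀ tx tb ty ta z, P tx tb ty ta z = ∑ c : 𝒞, Pc tx tb ty ta z c)
    (hand : ∀ tx tb ty ta z, z ≠ (ta && tb) → P tx tb ty ta z = 0)
    (hZpos : 0 < ∑ tx : 𝒳, ∑ tb : Bool, ∑ ty : 𝒴, ∑ ta : Bool, P tx tb ty ta true)
    (hABpos : ∀ ta tb : Bool, 0 < ∑ tx : 𝒳, ∑ ty : 𝒴, ∑ z : Bool, P tx tb ty ta z) :
    -- `Ã` and `B̃` are independent
    (∀ ta tb : Bool,
      (∑ tx : 𝒳, ∑ ty : 𝒴, ∑ z : Bool, P tx tb ty ta z)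
        = (∑ tb' : Bool, ∑ tx : 𝒳, ∑ ty : 𝒴, ∑ z : Bool, P tx tb' ty ta z)
          * (∑ ta' : Bool, ∑ tx : 𝒳, ∑ ty : 𝒴, ∑ z : Bool, P tx tb ty ta' z)) ∧
    -- local hidden-variable decomposition of `P(X̃,Ỹ | Ã,B̃)` with hidden variable `C`
    (∀ (tx : 𝒳) (ty : 𝒴) (ta tb : Bool),
      (∑ z : Bool, P tx tb ty ta z)
          / (∑ tx' : 𝒳, ∑ ty' : 𝒴, ∑ z : Bool, P tx' tb ty' ta z)
        = ∑ c ∈ Finset.univ.filter (fun c : 𝒞 => 0 < pC c),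
            pC c
              * ((∑ ty' : 𝒴, ∑ ta' : Bool, ∑ z : Bool, Pc tx tb ty' ta' z c)
                  / (∑ tx' : 𝒳, ∑ ty' : 𝒴, ∑ ta' : Bool, ∑ z : Bool, Pc tx' tb ty' ta' z c))
              * ((∑ tx' : 𝒳, ∑ tb' : Bool, ∑ z : Bool, Pc tx' tb' ty ta z c)
                  / (∑ tx' : 𝒳, ∑ ty' : 𝒴, ∑ tb' : Bool, ∑ z : Bool, Pc tx' tb' ty' ta z c))) := by
  have hsupp : ∀ a b c, pA a ≠ 0 → pB b ≠ 0 → pC c ≠ 0 → ∀ tb ta z, z ≠ (ta && tb) →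
      sndMarginal (κX (b, c)) tb = 0 ∨ sndMarginal (κY (a, c)) ta = 0 ∨ κZ (a, b) z = 0 := by
    intro a b c ha hb hc tb ta z hz
    by_contra! hcon
    obtain ⟨h1, h2, h3⟩ := hcon
    obtain ⟨tx, -, htx⟩ := Finset.exists_ne_zero_of_sum_ne_zero h1
    obtain ⟨ty, -, hty⟩ := Finset.exists_ne_zero_of_sum_ne_zero h2
    have h0 := hand tx tb ty ta z hz
    simp only [hP, hPc, Finset.sum_eq_zero_iff, Finset.mem_univ, true_imp_iff, mul_eq_zero] at h0
    have := h0 c a b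
    tauto
  obtain ⟨a₀, b₀, c₀, ha₀, hb₀, hc₀, hq⟩ :
      ∃ a b c, pA a ≠ 0 ∧ pB b ≠ 0 ∧ pC c ≠ 0 ∧ κZ (a, b) true ≠ 0 := by
    by_contra! hcon
    refine hZpos.ne' ?_
    simp only [hP, hPc, Finset.sum_eq_zero_iff, Finset.mem_univ, true_imp_iff, mul_eq_zero]
    intro tx tb ty ta c a b
    have := hcon a b c
    tauto
  obtain ⟨hU, hV⟩ := bits_independent_of_hidden
    (SA := fun a => pA a ≠ 0) (SB := fun b => pB b ≠ 0) (SC := fun c => pC c ≠ 0)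
    (U := fun b c => sndMarginal (κX (b, c))) (V := fun a c => sndMarginal (κY (a, c)))
    (fun b c => sum_sndMarginal (κX (b, c))) (fun a c => sum_sndMarginal (κY (a, c)))
    hsupp ha₀ hb₀ hq
  refine local_decomposition_of_marginals pC (averageKernel pB κX) (averageKernel pA κY)
    (fun t => ∑ x, averageKernel pB κX c₀ x t) (fun t => ∑ y, averageKernel pA κY c₀ y t)
    (sum_sum_averageKernel pB κX c₀) (sum_sum_averageKernel pA κY c₀) ?_ ?_ Pc ?_ P hP hABpos
  · intro c t hc
    simp only [sum_averageKernel]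
    refine Finset.sum_congr rfl fun b _ => ?_
    by_cases hb : pB b = 0
    · simp [hb]
    · exact congrArg (pB b * ·) (congrFun (hU b c c₀ hb hc hc₀) t)
  · intro c t hc
    simp only [sum_averageKernel]
    refine Finset.sum_congr rfl fun a _ => ?_
    by_cases ha : pA a = 0
    · simp [ha]
    · exact congrArg (pA a * ·) (congrFun (hV a c c₀ ha hc hc₀) t)
  · intro tx tb ty ta c
    simp only [hPc, averageKernel]
    calc _ = ∑ a, ∑ b, ∑ z, pA a * pB b * pC c * κX (b, c) (tx, tb) * κY (a, c) (ty, ta)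
            * κZ (a, b) z := by
          rw [Finset.sum_comm]
          exact Finset.sum_congr rfl fun _ _ => Finset.sum_comm
      _ = ∑ a, ∑ b, pC c * ((pB b * κX (b, c) (tx, tb)) * (pA a * κY (a, c) (ty, ta))) := by
          refine Finset.sum_congr rfl fun a _ => Finset.sum_congr rfl fun b _ => ?_
          rw [← Finset.mul_sum, PMF.sum_coe_eq_one]
          ring
      _ = _ := by
          rw [mul_assoc, Finset.sum_mul_sum, Finset.sum_comm]
          simp only [Finset.mul_sum]
end
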